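/- The following are equivalent: (i) every endomorphism of A₁ is an automorphism of A₁ (the Dixmier conjecture); (ii) for every endomorphism f of A₁ there exist involutions γ and δ on A₁, each conjugate to α, such that f ∘ γ = δ ∘ f (the γ,δ conjecture, first version). -/

import Mathlib

noncomputable section

/-- `f : A → A` is a `K`-algebra endomorphism (as a bare function). -/
def IsAlgEndo (K : Type) [CommSemiring K] {A : Type} [Semiring A] [Algebra K A]
    (f : A → A) : Prop :=
  (∀ a b : A, f (a + b) = f a + f b) ∧
  (∀ (c : K) (a : A), f (c • a) = c • f a) ∧
  (∀ a b : A, f (a * b) = f a * f b) ∧ f 1 = 1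

/-- `f : A → A` is a `K`-algebra automorphism: a bijective endomorphism. -/
def IsAlgAuto (K : Type) [CommSemiring K] {A : Type} [Semiring A] [Algebra K A]
    (f : A → A) : Prop :=
  IsAlgEndo K f ∧ Function.Bijective f

/-- `f : A → A` is a `K`-linear anti-endomorphism. -/
def IsAntiEndo (K : Type) [CommSemiring K] {A : Type} [Semiring A] [Algebra K A]
    (f : A → A) : Prop :=
  (∀ a b : A, f (a + b) = f a + f b) ∧
  (∀ (c : K) (a : A), f (c • a) = c • f a) ∧
  (∀ a b : A, f (a * b) = f b * f a) ∧ f 1 = 1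

/-- `f : A → A` is an anti-automorphism: a bijective anti-endomorphism. -/
def IsAntiAuto (K : Type) [CommSemiring K] {A : Type} [Semiring A] [Algebra K A]
    (f : A → A) : Prop :=
  IsAntiEndo K f ∧ Function.Bijective f

/-- An involution on a `K`-algebra: an anti-automorphism of order at most two. -/
def IsInvolutionOn (K : Type) [CommSemiring K] {A : Type} [Semiring A] [Algebra K A]
    (γ : A → A) : Prop :=
  IsAntiAuto K γ ∧ γ ∘ γ = id

/-- The defining relation of the first Weyl algebra: `Y*X = X*Y + 1`. -/
inductive WeylRel (K : Type) [CommSemiring K] :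
    FreeAlgebra K (Fin 2) → FreeAlgebra K (Fin 2) → Prop
  | rel : WeylRel K (FreeAlgebra.ι K 1 * FreeAlgebra.ι K 0)
      (FreeAlgebra.ι K 0 * FreeAlgebra.ι K 1 + 1)

/-- The first Weyl algebra `A₁(K) = K⟨X,Y⟩/(YX - XY - 1)`. -/
abbrev Weyl (K : Type) [CommSemiring K] : Type := RingQuot (WeylRel K)

/-- The generator `X` of the Weyl algebra. -/
def Wx (K : Type) [CommSemiring K] : Weyl K :=
  RingQuot.mkAlgHom K (WeylRel K) (FreeAlgebra.ι K 0)

/-- The generator `Y` of the Weyl algebra. -/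
def Wy (K : Type) [CommSemiring K] : Weyl K :=
  RingQuot.mkAlgHom K (WeylRel K) (FreeAlgebra.ι K 1)

/-- `α` is the exchange involution: the involution with `α X = Y` and `α Y = X`. -/
def IsExchange (K : Type) [CommSemiring K] (α : Weyl K → Weyl K) : Prop :=
  IsInvolutionOn K α ∧ α (Wx K) = Wy K ∧ α (Wy K) = Wx K

/-- `γ` is conjugate to `α` by an automorphism or an anti-automorphism:
`γ = g⁻¹ ∘ α ∘ g`. -/
def ConjToAlpha (K : Type) [CommSemiring K] (α γ : Weyl K → Weyl K) : Prop :=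
  ∃ g : Weyl K → Weyl K, (IsAlgAuto K g ∨ IsAntiAuto K g) ∧
    γ = Function.invFun g ∘ α ∘ g


namespace WD

section basics
variable {R : Type} [CommRing R]

theorem wrel (R : Type) [CommRing R] : Wy R * Wx R = Wx R * Wy R + 1 := by
  have h := RingQuot.mkAlgHom_rel R (WeylRel.rel (K := R))
  simpa [Wx, Wy, map_mul, map_add] using h

/-- universal property -/
def wlift {B : Type} [Ring B] [Algebra R B] (s a : B) (h : a * s = s * a + 1) : Weyl R →ₐ[R] B :=
  RingQuot.liftAlgHom R ⟨FreeAlgebra.lift R ![s, a], by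
    intro u v huv
    cases huv
    simp [h]⟩

@[simp] theorem wlift_x {B : Type} [Ring B] [Algebra R B] (s a : B) (h : a * s = s * a + 1) :
    wlift (R := R) s a h (Wx R) = s := by
  simp [wlift, Wx]

@[simp] theorem wlift_y {B : Type} [Ring B] [Algebra R B] (s a : B) (h : a * s = s * a + 1) :
    wlift (R := R) s a h (Wy R) = a := by
  simp [wlift, Wy]

/-- induction from left multiplication by generators -/
theorem w_ind (P : Submodule R (Weyl R)) (h1 : (1 : Weyl R) ∈ P)
    (hx : ∀ u ∈ P, Wx R * u ∈ P) (hy : ∀ u ∈ P, Wy R * u ∈ P) (u : Weyl R) : u ∈ P := by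
  obtain ⟨w, rfl⟩ := RingQuot.mkAlgHom_surjective R (WeylRel R) u
  suffices H : ∀ v ∈ P, RingQuot.mkAlgHom R (WeylRel R) w * v ∈ P by simpa using H 1 h1
  induction w using FreeAlgebra.induction with
  | grade0 r => intro v hv; simpa [Algebra.smul_def] using P.smul_mem r hv
  | grade1 i =>
    intro v hv
    fin_cases i
    · exact hx v hv
    · exact hy v hv
  | mul a b ha hb => intro v hv; rw [map_mul, mul_assoc]; exact ha _ (hb _ hv)
  | add a b ha hb => intro v hv; rw [map_add, add_mul]; exact P.add_mem (ha _ hv) (hb _ hv)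

theorem hom_ext {B : Type} [Ring B] [Algebra R B] (f g : Weyl R →ₐ[R] B)
    (hx : f (Wx R) = g (Wx R)) (hy : f (Wy R) = g (Wy R)) : f = g := by
  refine AlgHom.ext fun u => ?_
  refine w_ind (LinearMap.eqLocus f.toLinearMap g.toLinearMap) (by simp [LinearMap.mem_eqLocus]) ?_ ?_ u
  · intro u hu; simp [LinearMap.mem_eqLocus] at hu ⊢; rw [hu, hx]
  · intro u hu; simp [LinearMap.mem_eqLocus] at hu ⊢; rw [hu, hy]

def opx (R : Type) [CommRing R] : Module.End R ((ℕ × ℕ) →₀ R) :=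
  Finsupp.linearCombination R (fun q : ℕ × ℕ => Finsupp.single (q.1 + 1, q.2) (1 : R))

def opy (R : Type) [CommRing R] : Module.End R ((ℕ × ℕ) →₀ R) :=
  Finsupp.linearCombination R (fun q : ℕ × ℕ =>
    Finsupp.single (q.1 - 1, q.2) (q.1 : R) + Finsupp.single (q.1, q.2 + 1) (1 : R))

theorem op_rel : opy R * opx R = opx R * opy R + 1 := by
  refine Finsupp.lhom_ext' fun q => LinearMap.ext_ring ?_
  obtain ⟨i, j⟩ := q
  rcases i with _ | i
  · simp [opx, opy]; abel
  · simp [opx, opy, Finsupp.linearCombination_single, Finsupp.single_add]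
    abel

def rep (R : Type) [CommRing R] : Weyl R →ₐ[R] Module.End R ((ℕ × ℕ) →₀ R) :=
  wlift (opx R) (opy R) op_rel

/-- coefficients in the normal form -/
def cf (R : Type) [CommRing R] : Weyl R →ₗ[R] ((ℕ × ℕ) →₀ R) :=
  (LinearMap.applyₗ (Finsupp.single (0, 0) (1 : R))).comp (rep R).toLinearMap

def mon (R : Type) [CommRing R] (i j : ℕ) : Weyl R := Wx R ^ i * Wy R ^ j

theorem cf_mon (i j : ℕ) : cf R (mon R i j) = Finsupp.single (i, j) 1 := by
  have hy : ∀ j, (opy R ^ j) (Finsupp.single (0, 0) 1) = Finsupp.single (0, j) 1 := by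
    intro j
    induction j with
    | zero => simp
    | succ j ih => rw [pow_succ', Module.End.mul_apply, ih]; simp [opy]
  have hx : ∀ i, (opx R ^ i) (Finsupp.single (0, j) 1) = Finsupp.single (i, j) 1 := by
    intro i
    induction i with
    | zero => simp
    | succ j ih => rw [pow_succ', Module.End.mul_apply, ih]; simp [opx]
  simp [cf, rep, mon, hy, hx]

theorem comm_pow_x {B : Type} [Ring B] {s a : B} (h : a * s = s * a + 1) (i : ℕ) :
    a * s ^ i = s ^ i * a + (i : B) * s ^ (i - 1) := by
  induction i with
  | zero => simp
  | succ i ih =>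
    rcases i with _ | i
    · simp [h]
    · rw [pow_succ, ← mul_assoc, ih, add_mul, mul_assoc (s ^ (i + 1)), h]
      simp only [Nat.add_sub_cancel, mul_add, mul_one]
      rw [mul_assoc ((_ : ℕ) : B), ← pow_succ]
      push_cast
      noncomm_ring

theorem comm_pow_y {B : Type} [Ring B] {s a : B} (h : a * s = s * a + 1) (i : ℕ) :
    a ^ i * s = s * a ^ i + (i : B) * a ^ (i - 1) := by
  have h' : (-s) * a = a * (-s) + 1 := by rw [mul_neg, h]; noncomm_ring
  have := comm_pow_x h' i
  have h2 : a ^ i * s = s * a ^ i + ((-s) * a ^ i - a ^ i * (-s)) := by noncomm_ring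
  rw [h2, this]; noncomm_ring

theorem y_mon (i j : ℕ) : Wy R * mon R i j = mon R i (j + 1) + (i : R) • mon R (i - 1) j := by
  simp only [mon]
  rw [← mul_assoc, comm_pow_x (wrel R), add_mul, mul_assoc, ← pow_succ', mul_assoc]
  simp [Algebra.smul_def]

theorem mon_x (i j : ℕ) : mon R i j * Wx R = mon R (i + 1) j + (j : R) • mon R i (j - 1) := by
  simp only [mon]
  rw [mul_assoc, comm_pow_y (wrel R), mul_add, ← mul_assoc, ← pow_succ]
  simp only [Algebra.smul_def, map_natCast]
  rw [← mul_assoc, ← Nat.cast_comm, mul_assoc]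

theorem w_sum (u : Weyl R) : u = (cf R u).sum (fun q c => c • mon R q.1 q.2) := by
  have key : ∀ u, u ∈ LinearMap.eqLocus
      ((Finsupp.linearCombination R (fun q : ℕ × ℕ => mon R q.1 q.2)).comp (cf R)) LinearMap.id := by
    have hr : ∀ u : Weyl R, u ∈ Submodule.span R (Set.range fun q : ℕ × ℕ => mon R q.1 q.2) := by
      refine w_ind _ (Submodule.subset_span ⟨(0, 0), by simp [mon]⟩) ?_ ?_
      · intro u hu
        induction hu using Submodule.span_induction with
        | mem u h =>
          obtain ⟨q, rfl⟩ := h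
          exact Submodule.subset_span ⟨(q.1 + 1, q.2), by simp [mon, pow_succ', mul_assoc]⟩
        | zero => simp
        | add a b _ _ ha hb => rw [mul_add]; exact Submodule.add_mem _ ha hb
        | smul r a _ ha => rw [mul_smul_comm]; exact Submodule.smul_mem _ _ ha
      · intro u hu
        induction hu using Submodule.span_induction with
        | mem u h =>
          obtain ⟨q, rfl⟩ := h
          simp only [y_mon]
          exact Submodule.add_mem _ (Submodule.subset_span ⟨(q.1, q.2 + 1), rfl⟩)
            (Submodule.smul_mem _ _ (Submodule.subset_span ⟨(q.1 - 1, q.2), rfl⟩))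
        | zero => simp
        | add a b _ _ ha hb => rw [mul_add]; exact Submodule.add_mem _ ha hb
        | smul r a _ ha => rw [mul_smul_comm]; exact Submodule.smul_mem _ _ ha
    intro u
    refine (Submodule.span_le.2 ?_) (hr u)
    rintro _ ⟨q, rfl⟩
    simp [LinearMap.mem_eqLocus, cf_mon]
  have := key u
  simp only [LinearMap.mem_eqLocus, LinearMap.comp_apply, LinearMap.id_apply] at this
  conv_lhs => rw [← this]
  rfl

theorem cf_inj {u v : Weyl R} (h : cf R u = cf R v) : u = v := by
  rw [w_sum u, w_sum v, h]

theorem lin_ext {M : Type} [AddCommMonoid M] [Module R M] (f g : Weyl R →ₗ[R] M)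
    (h : ∀ i j, f (mon R i j) = g (mon R i j)) : f = g := by
  refine LinearMap.ext fun u => ?_
  rw [w_sum u]
  simp [Finsupp.sum, h]

/-- existence of element with given coefficients -/
def ofc (R : Type) [CommRing R] (c : (ℕ × ℕ) →₀ R) : Weyl R := c.sum (fun q r => r • mon R q.1 q.2)

theorem cf_ofc (c : (ℕ × ℕ) →₀ R) : cf R (ofc R c) = c := by
  simp [ofc, Finsupp.sum, map_sum, cf_mon]
  exact Finsupp.sum_single c

/-- base change -/
def bc (R R' : Type) [CommRing R] [CommRing R'] [Algebra R R'] : Weyl R →ₐ[R] Weyl R' :=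
  wlift (Wx R') (Wy R') (wrel R')

theorem bc_mon (R R' : Type) [CommRing R] [CommRing R'] [Algebra R R'] (i j : ℕ) :
    bc R R' (mon R i j) = mon R' i j := by simp [bc, mon]

theorem cf_bc (R R' : Type) [CommRing R] [CommRing R'] [Algebra R R'] (u : Weyl R) (q : ℕ × ℕ) :
    cf R' (bc R R' u) q = algebraMap R R' (cf R u q) := by
  conv_lhs => rw [w_sum u]
  simp only [Finsupp.sum, map_sum, map_smul, bc_mon]
  have : ∀ (r : R) (w : Weyl R'), r • w = algebraMap R R' r • w := by
    intro r w; rw [algebraMap_smul]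
  simp only [this, map_smul, cf_mon, Finsupp.coe_finsetSum, Finset.sum_apply]
  simp [Finsupp.single_apply]
  split_ifs with h
  · simp [Algebra.smul_def]
  · simp only [Finsupp.mem_support_iff, not_not] at h
    simp [h]

end basics
end WD

namespace WD
section azumaya
variable {B : Type} [Ring B]

/-- commutator as a linear map over the center -/
def adz (a : B) : B →ₗ[Subring.center B] B where
  toFun b := a * b - b * a
  map_add' := by intro b c; noncomm_ring
  map_smul' := by
    intro z b
    have hz := Subring.mem_center_iff.1 z.2 a
    simp only [Subring.smul_def, smul_eq_mul, RingHom.id_apply]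
    rw [← mul_assoc, hz]; noncomm_ring

theorem smul_top_stable (I : Ideal (Subring.center B)) (f : B →ₗ[Subring.center B] B) {b : B}
    (hb : b ∈ I • (⊤ : Submodule (Subring.center B) B)) :
    f b ∈ I • (⊤ : Submodule (Subring.center B) B) := by
  refine Submodule.smul_induction_on hb ?_ ?_
  · intro r hr n _
    rw [map_smul]
    exact Submodule.smul_mem_smul hr trivial
  · intro x y hx hy
    rw [map_add]; exact Submodule.add_mem _ hx hy

theorem cancel_nat {p : ℕ} (hp : p.Prime) (hB : (p : B) = 0)
    (J : Submodule (Subring.center B) B) (n : ℕ) (h0 : 0 < n) (hn : n < p) (b : B)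
    (h : (n : B) * b ∈ J) : b ∈ J := by
  have hc : Nat.Coprime n p :=
    ((Nat.Prime.coprime_iff_not_dvd hp).2 (Nat.not_dvd_of_pos_of_lt h0 hn)).symm
  have hz : (n : ℤ) * n.gcdA p + p * n.gcdB p = 1 := by
    rw [← Nat.gcd_eq_gcd_ab, hc]; simp
  have hz' : ((n.gcdA p : ℤ) : B) * (n : B) = 1 := by
    have := congrArg (Int.cast : ℤ → B) hz
    push_cast at this
    rw [hB, zero_mul, add_zero] at this
    rw [← this, Int.cast_comm]
  have : b = (n.gcdA p) • ((n : B) * b) := by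
    rw [zsmul_eq_mul, ← mul_assoc, hz', one_mul]
  rw [this]
  exact J.toAddSubgroup.zsmul_mem h _

theorem step {p : ℕ} (hp : p.Prime) (hB : (p : B) = 0) {s a : B} (h : a * s = s * a + 1)
    (I : Ideal (Subring.center B)) (n : ℕ) (hn : n ≤ p) (b : ℕ → B) (hb : ∀ i, a * b i = b i * a)
    (hs : ∑ i ∈ Finset.range n, s ^ i * b i ∈ I • (⊤ : Submodule (Subring.center B) B)) :
    ∀ i < n, b i ∈ I • (⊤ : Submodule (Subring.center B) B) := by
  induction n generalizing b with
  | zero => intro i hi; omega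
  | succ n ih =>
    have h1 := smul_top_stable I (adz a) hs
    have e1 : adz a (∑ i ∈ Finset.range (n + 1), s ^ i * b i)
        = ∑ i ∈ Finset.range n, s ^ i * (((i + 1 : ℕ) : B) * b (i + 1)) := by
      rw [map_sum, Finset.sum_range_succ']
      have : ∀ i, adz a (s ^ i * b i) = (i : B) * (s ^ (i - 1) * b i) := by
        intro i
        change a * (s ^ i * b i) - s ^ i * b i * a = _
        rw [← mul_assoc, comm_pow_x h, add_mul, mul_assoc (s ^ i) a, hb]
        noncomm_ring
      simp only [this]
      simp only [Nat.cast_zero, zero_mul, add_zero, Nat.add_sub_cancel]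
      refine Finset.sum_congr rfl fun i _ => ?_
      rw [← mul_assoc, Nat.cast_comm, mul_assoc]
    rw [e1] at h1
    have h2 := ih (by omega) (fun i => ((i + 1 : ℕ) : B) * b (i + 1)) (by
      intro i
      rw [← mul_assoc, ← Nat.cast_comm, mul_assoc, hb, mul_assoc]) h1
    have h3 : ∀ i < n, b (i + 1) ∈ I • (⊤ : Submodule (Subring.center B) B) := by
      intro i hi
      exact cancel_nat hp hB _ (i + 1) (by omega) (by omega) _ (h2 i hi)
    rw [Finset.sum_range_succ'] at hs
    have h4 : ∑ i ∈ Finset.range n, s ^ (i + 1) * b (i + 1) ∈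
        I • (⊤ : Submodule (Subring.center B) B) := by
      refine Submodule.sum_mem _ fun i hi => ?_
      exact smul_top_stable I (LinearMap.mulLeft (Subring.center B) (s ^ (i + 1)))
        (h3 i (Finset.mem_range.1 hi))
    have h5 := (Submodule.add_mem_iff_right _ h4).1 hs
    intro i hi
    rcases i with _ | i
    · simpa using h5
    · exact h3 i (by omega)

theorem indep_mod {p : ℕ} (hp : p.Prime) (hB : (p : B) = 0) {s a : B} (h : a * s = s * a + 1)
    (I : Ideal (Subring.center B)) (c : Fin p × Fin p → Subring.center B)
    (hs : ∑ q, c q • (s ^ (q.1 : ℕ) * a ^ (q.2 : ℕ)) ∈ I • (⊤ : Submodule (Subring.center B) B)) :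
    ∀ q, c q • (1 : B) ∈ I • (⊤ : Submodule (Subring.center B) B) := by
  classical
  let c' : ℕ → ℕ → Subring.center B := fun i j =>
    if hi : i < p then if hj : j < p then c (⟨i, hi⟩, ⟨j, hj⟩) else 0 else 0
  have hc' : ∀ q : Fin p × Fin p, c q = c' q.1 q.2 := by
    intro q; simp [c']
  have hcen : ∀ (z : Subring.center B) (b : B), (z : B) * b = b * z := fun z b =>
    (Subring.mem_center_iff.1 z.2 b).symm
  let b : ℕ → B := fun i => ∑ j ∈ Finset.range p, a ^ j * (c' i j : B)
  have hsum : ∑ q, c q • (s ^ (q.1 : ℕ) * a ^ (q.2 : ℕ)) = ∑ i ∈ Finset.range p, s ^ i * b i := by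
    rw [Fintype.sum_prod_type, Finset.sum_range]
    refine Finset.sum_congr rfl fun i _ => ?_
    simp only [b]
    rw [Finset.mul_sum, Finset.sum_range]
    refine Finset.sum_congr rfl fun j _ => ?_
    rw [hc', Subring.smul_def, smul_eq_mul, hcen, mul_assoc]
  rw [hsum] at hs
  have h1 := step hp hB h I p le_rfl b (by
    intro i
    simp only [b]
    rw [Finset.mul_sum, Finset.sum_mul]
    refine Finset.sum_congr rfl fun j _ => ?_
    rw [← mul_assoc, ← pow_succ', mul_assoc, hcen, ← mul_assoc, ← pow_succ]) hs
  have h' : (-s) * a = a * (-s) + 1 := by rw [mul_neg, h]; noncomm_ring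
  intro q
  have h2 := step hp hB h' I p le_rfl (fun j => (c' q.1 j : B)) (by
    intro j; exact (hcen _ _).symm) (h1 q.1 q.1.2) q.2 q.2.2
  rw [hc', Subring.smul_def, smul_eq_mul, mul_one]
  exact h2

theorem span_of_span {p : ℕ} (hp : p.Prime) (hB : (p : B) = 0) {x y : B} (h : y * x = x * y + 1)
    (hspan : Submodule.span (Subring.center B)
      (Set.range fun q : Fin p × Fin p => x ^ (q.1 : ℕ) * y ^ (q.2 : ℕ)) = ⊤)
    {s a : B} (h' : a * s = s * a + 1) :
    Submodule.span (Subring.center B)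
      (Set.range fun q : Fin p × Fin p => s ^ (q.1 : ℕ) * a ^ (q.2 : ℕ)) = ⊤ := by
  classical
  have hli : LinearIndependent (Subring.center B)
      (fun q : Fin p × Fin p => x ^ (q.1 : ℕ) * y ^ (q.2 : ℕ)) := by
    rw [Fintype.linearIndependent_iff]
    intro c hc q
    have := indep_mod hp hB h ⊥ c (by rw [hc]; exact Submodule.zero_mem _) q
    rw [Submodule.bot_smul, Submodule.mem_bot, Subring.smul_def, smul_eq_mul, mul_one] at this
    exact Subtype.ext this
  let bs := Module.Basis.mk hli hspan.ge
  have hbs : ∀ q, bs q = x ^ (q.1 : ℕ) * y ^ (q.2 : ℕ) := fun q => by simp [bs]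
  let e : Fin p × Fin p → B := fun q => s ^ (q.1 : ℕ) * a ^ (q.2 : ℕ)
  refine ((Module.Basis.is_basis_iff_det bs (v := e)).2 ?_).2
  by_contra hdet
  obtain ⟨m, hm, hmem⟩ := exists_max_ideal_of_mem_nonunits hdet
  let _ := Ideal.Quotient.field m
  have hd0 : (((bs.toMatrix e)).map (Ideal.Quotient.mk m)).det = 0 := by
    rw [← RingHom.mapMatrix_apply, ← RingHom.map_det]
    exact Ideal.Quotient.eq_zero_iff_mem.2 hmem
  obtain ⟨v, hv0, hv⟩ := Matrix.exists_mulVec_eq_zero_iff.2 hd0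
  have hsurj : ∀ q, ∃ c : Subring.center B, Ideal.Quotient.mk m c = v q := fun q =>
    Ideal.Quotient.mk_surjective (v q)
  choose c hc using hsurj
  have hrepr : ∀ r, bs.repr (∑ q, c q • e q) r ∈ m := by
    intro r
    rw [← Ideal.Quotient.eq_zero_iff_mem]
    have := congrFun hv r
    simp only [Matrix.mulVec, dotProduct, Matrix.map_apply, Pi.zero_apply, Module.Basis.toMatrix_apply] at this
    rw [← this]
    simp only [map_sum, map_smul, Finsupp.coe_finsetSum, Finset.sum_apply, Finsupp.smul_apply,
      smul_eq_mul, map_mul, hc]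
    exact Finset.sum_congr rfl fun q _ => mul_comm _ _
  have hmem2 : ∑ q, c q • e q ∈ m • (⊤ : Submodule (Subring.center B) B) := by
    rw [← bs.sum_repr (∑ q, c q • e q)]
    exact Submodule.sum_mem _ fun r _ => Submodule.smul_mem_smul (hrepr r) trivial
  have h1 := indep_mod hp hB h' m c hmem2
  apply hv0
  funext q
  rw [← hc, Pi.zero_apply, Ideal.Quotient.eq_zero_iff_mem]
  have h2 := h1 q
  have hlin : ∀ b ∈ m • (⊤ : Submodule (Subring.center B) B), ∀ r, bs.repr b r ∈ m := by
    intro b hb r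
    refine Submodule.smul_induction_on hb ?_ ?_
    · intro z hz n _
      simp only [map_smul, Finsupp.smul_apply, smul_eq_mul]
      exact m.mul_mem_right _ hz
    · intro b1 b2 h1 h2
      rw [map_add]; exact m.add_mem h1 h2
  have h3 := hlin _ h2 (⟨0, hp.pos⟩, ⟨0, hp.pos⟩)
  have h4 : (1 : B) = bs (⟨0, hp.pos⟩, ⟨0, hp.pos⟩) := by rw [hbs]; simp
  rw [map_smul, h4, Module.Basis.repr_self] at h3
  simpa using h3

theorem pow_central {p : ℕ} (hp : p.Prime) (hB : (p : B) = 0) {x y : B} (h : y * x = x * y + 1)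
    (hspan : Submodule.span (Subring.center B)
      (Set.range fun q : Fin p × Fin p => x ^ (q.1 : ℕ) * y ^ (q.2 : ℕ)) = ⊤)
    {s a : B} (h' : a * s = s * a + 1) :
    s ^ p ∈ Subring.center B ∧ a ^ p ∈ Subring.center B := by
  have hs := span_of_span hp hB h hspan h'
  have hsa : Commute (s ^ p) a := by
    have := comm_pow_x h' p
    rw [hB, zero_mul, add_zero] at this
    exact this.symm
  have has : Commute (a ^ p) s := by
    have := comm_pow_y h' p
    rw [hB, zero_mul, add_zero] at this
    exact this
  have key : ∀ t : B, Commute t s → Commute t a → t ∈ Subring.center B := by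
    intro t hts hta
    rw [Subring.mem_center_iff]
    intro g
    have hg : g ∈ Submodule.span (Subring.center B)
      (Set.range fun q : Fin p × Fin p => s ^ (q.1 : ℕ) * a ^ (q.2 : ℕ)) := by rw [hs]; trivial
    induction hg using Submodule.span_induction with
    | mem u hu =>
      obtain ⟨q, rfl⟩ := hu
      exact ((hts.pow_right _).mul_right (hta.pow_right _)).symm
    | zero => simp
    | add u v _ _ hu hv => rw [add_mul, mul_add, hu, hv]
    | smul z u _ hu =>
      rw [smul_mul_assoc, mul_smul_comm, hu]
  exact ⟨key _ ((Commute.refl s).pow_left p) hsa, key _ has ((Commute.refl a).pow_left p)⟩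

end azumaya
end WD
namespace WD
section charp
variable {R : Type} [CommRing R]

theorem commute_of_gens (u : Weyl R) (hx : Commute u (Wx R)) (hy : Commute u (Wy R)) :
    u ∈ Subring.center (Weyl R) := by
  rw [Subring.mem_center_iff]
  intro g
  rw [w_sum g]
  simp only [Finsupp.sum, Finset.sum_mul, Finset.mul_sum]
  refine Finset.sum_congr rfl fun q _ => ?_
  rw [smul_mul_assoc, mul_smul_comm]
  congr 1
  exact ((hx.pow_right _).mul_right (hy.pow_right _)).symm

theorem cf_y (u : Weyl R) (i j : ℕ) :
    cf R (Wy R * u - u * Wy R) (i, j) = ((i + 1 : ℕ) : R) * cf R u (i + 1, j) := by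
  have := lin_ext (R := R)
    ((Finsupp.lapply (i, j)).comp ((cf R).comp
      (LinearMap.mulLeft R (Wy R) - LinearMap.mulRight R (Wy R))))
    (((i + 1 : ℕ) : R) • ((Finsupp.lapply (i + 1, j)).comp (cf R))) (by
      intro k l
      have h2 : mon R k l * Wy R = mon R k (l + 1) := by simp [mon, pow_succ, mul_assoc]
      simp only [LinearMap.comp_apply, LinearMap.sub_apply, LinearMap.mulLeft_apply,
        LinearMap.mulRight_apply, y_mon, h2, add_sub_cancel_left, map_smul, cf_mon,
        LinearMap.smul_apply, Finsupp.lapply_apply, Finsupp.single_apply, smul_eq_mul]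
      rcases k with _ | k
      · simp
      · simp only [Nat.add_sub_cancel, Prod.mk.injEq, Nat.add_right_cancel_iff]
        split_ifs with h
        · rw [h.1]
        · simp)
  exact LinearMap.congr_fun this u

theorem cf_x (u : Weyl R) (i j : ℕ) :
    cf R (u * Wx R - Wx R * u) (i, j) = ((j + 1 : ℕ) : R) * cf R u (i, j + 1) := by
  have := lin_ext (R := R)
    ((Finsupp.lapply (i, j)).comp ((cf R).comp
      (LinearMap.mulRight R (Wx R) - LinearMap.mulLeft R (Wx R))))
    (((j + 1 : ℕ) : R) • ((Finsupp.lapply (i, j + 1)).comp (cf R))) (by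
      intro k l
      have h2 : Wx R * mon R k l = mon R (k + 1) l := by simp [mon, pow_succ', mul_assoc]
      simp only [LinearMap.comp_apply, LinearMap.sub_apply, LinearMap.mulLeft_apply,
        LinearMap.mulRight_apply, mon_x, h2, add_sub_cancel_left, map_smul, cf_mon,
        LinearMap.smul_apply, Finsupp.lapply_apply, Finsupp.single_apply, smul_eq_mul]
      rcases l with _ | l
      · simp
      · simp only [Nat.add_sub_cancel, Prod.mk.injEq, Nat.add_right_cancel_iff]
        split_ifs with h
        · rw [h.2]
        · simp)
  exact LinearMap.congr_fun this u

theorem nat_cancel {p : ℕ} (hp : p.Prime) (h0 : (p : R) = 0) (n : ℕ) (hn : ¬ p ∣ n) (b : R)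
    (h : (n : R) * b = 0) : b = 0 := by
  have hc : Nat.Coprime n p := ((Nat.Prime.coprime_iff_not_dvd hp).2 hn).symm
  have hz : (n : ℤ) * n.gcdA p + p * n.gcdB p = 1 := by
    rw [← Nat.gcd_eq_gcd_ab, hc]; simp
  have hz' : (n : R) * ((n.gcdA p : ℤ) : R) = 1 := by
    have := congrArg (Int.cast : ℤ → R) hz
    push_cast at this
    rwa [h0, zero_mul, add_zero] at this
  calc b = ((n : R) * b) * ((n.gcdA p : ℤ) : R) := by rw [mul_right_comm, hz', one_mul]
    _ = 0 := by rw [h, zero_mul]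

theorem central_cf {p : ℕ} (hp : p.Prime) (h0 : (p : R) = 0) (u : Weyl R)
    (hu : u ∈ Subring.center (Weyl R)) (i j : ℕ) (h : ¬ (p ∣ i ∧ p ∣ j)) : cf R u (i, j) = 0 := by
  rw [Subring.mem_center_iff] at hu
  by_cases hi : p ∣ i
  · have hj : ¬ p ∣ j := fun hj => h ⟨hi, hj⟩
    rcases j with _ | j
    · simp at hj
    have := cf_x u i j
    rw [← hu, sub_self, map_zero, Finsupp.zero_apply] at this
    exact nat_cancel hp h0 _ hj _ this.symm
  · rcases i with _ | i
    · simp at hi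
    have := cf_y u i j
    rw [hu, sub_self, map_zero, Finsupp.zero_apply] at this
    exact nat_cancel hp h0 _ hi _ this.symm

theorem w_cast {p : ℕ} (h0 : (p : R) = 0) : (p : Weyl R) = 0 := by
  rw [← map_natCast (algebraMap R (Weyl R)), h0, map_zero]

theorem xp_central {p : ℕ} (h0 : (p : R) = 0) : Wx R ^ p ∈ Subring.center (Weyl R) := by
  refine commute_of_gens _ ((Commute.refl _).pow_left p) ?_
  have := comm_pow_x (wrel R) p
  rw [w_cast h0, zero_mul, add_zero] at this
  exact this.symm

theorem yp_central {p : ℕ} (h0 : (p : R) = 0) : Wy R ^ p ∈ Subring.center (Weyl R) := by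
  refine commute_of_gens _ ?_ ((Commute.refl _).pow_left p)
  have := comm_pow_y (wrel R) p
  rw [w_cast h0, zero_mul, add_zero] at this
  exact this

theorem w_span {p : ℕ} (hp : p.Prime) (h0 : (p : R) = 0) :
    Submodule.span (Subring.center (Weyl R))
      (Set.range fun q : Fin p × Fin p => Wx R ^ (q.1 : ℕ) * Wy R ^ (q.2 : ℕ)) = ⊤ := by
  rw [eq_top_iff]
  intro u _
  rw [w_sum u]
  refine Submodule.sum_mem _ fun q _ => ?_
  have hz : algebraMap R (Weyl R) (cf R u q) * ((Wx R ^ p) ^ (q.1 / p) * (Wy R ^ p) ^ (q.2 / p))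
      ∈ Subring.center (Weyl R) := by
    refine Subring.mul_mem _ ?_ (Subring.mul_mem _ (Subring.pow_mem _ (xp_central h0) _)
      (Subring.pow_mem _ (yp_central h0) _))
    rw [Subring.mem_center_iff]
    intro g
    exact (Algebra.commutes _ _).symm
  have h1 : cf R u q • mon R q.1 q.2 = (⟨_, hz⟩ : Subring.center (Weyl R)) •
      (Wx R ^ (q.1 % p) * Wy R ^ (q.2 % p)) := by
    rw [Subring.smul_def, smul_eq_mul]
    have hc := Subring.mem_center_iff.1 (Subring.pow_mem _ (yp_central (R := R) h0) (q.2 / p))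
    simp only [mon, Algebra.smul_def]
    conv_lhs => rw [← Nat.div_add_mod q.1 p, ← Nat.div_add_mod q.2 p]
    rw [pow_add, pow_add, pow_mul, pow_mul]
    simp only [mul_assoc]
    congr 2
    rw [← mul_assoc, hc, mul_assoc]
  change cf R u q • mon R q.1 q.2 ∈ _
  rw [h1]
  exact Submodule.smul_mem _ _ (Submodule.subset_span
    ⟨(⟨q.1 % p, Nat.mod_lt _ hp.pos⟩, ⟨q.2 % p, Nat.mod_lt _ hp.pos⟩), rfl⟩)

/-- p-th powers are p-supported mod p -/
theorem pow_supp {p : ℕ} (hp : p.Prime) (h0 : (p : R) = 0) {s a : Weyl R}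
    (h : a * s = s * a + 1) (i j : ℕ) (hij : ¬ (p ∣ i ∧ p ∣ j)) :
    cf R (s ^ p) (i, j) = 0 ∧ cf R (a ^ p) (i, j) = 0 := by
  have := pow_central hp (w_cast h0) (wrel R) (w_span hp h0) h
  exact ⟨central_cf hp h0 _ this.1 i j hij, central_cf hp h0 _ this.2 i j hij⟩

end charp

section degs
variable {R : Type} [CommRing R]

/-- degree box -/
def Fm (R : Type) [CommRing R] (m n : ℕ) : Submodule R (Weyl R) :=
  Submodule.span R {u | ∃ i j, i ≤ m ∧ j ≤ n ∧ u = mon R i j}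

theorem mem_Fm_iff (m n : ℕ) (u : Weyl R) :
    u ∈ Fm R m n ↔ ∀ i j, ¬ (i ≤ m ∧ j ≤ n) → cf R u (i, j) = 0 := by
  constructor
  · intro hu i j hij
    induction hu using Submodule.span_induction with
    | mem u h =>
      obtain ⟨k, l, hk, hl, rfl⟩ := h
      rw [cf_mon, Finsupp.single_apply, if_neg]
      rintro ⟨⟩
      exact hij ⟨hk, hl⟩
    | zero => simp
    | add a b _ _ ha hb => simp [ha, hb]
    | smul r a _ ha => simp [ha]
  · intro h
    rw [w_sum u]
    refine Submodule.sum_mem _ fun q hq => Submodule.smul_mem _ _ (Submodule.subset_span ?_)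
    refine ⟨q.1, q.2, ?_, ?_, rfl⟩
    all_goals
      by_contra hc
      exact Finsupp.mem_support_iff.1 hq (h q.1 q.2 (by omega))

theorem Fm_mono {m n m' n' : ℕ} (hm : m ≤ m') (hn : n ≤ n') : Fm R m n ≤ Fm R m' n' := by
  intro u
  simp only [mem_Fm_iff]
  intro h i j hij
  exact h i j (by omega)

theorem Fm_x (m n : ℕ) (u : Weyl R) (hu : u ∈ Fm R m n) : Wx R * u ∈ Fm R (m + 1) n := by
  induction hu using Submodule.span_induction with
  | mem u h =>
    obtain ⟨k, l, hk, hl, rfl⟩ := h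
    exact Submodule.subset_span ⟨k + 1, l, by omega, hl, by simp [mon, pow_succ', mul_assoc]⟩
  | zero => simp
  | add a b _ _ ha hb => rw [mul_add]; exact Submodule.add_mem _ ha hb
  | smul r a _ ha => rw [mul_smul_comm]; exact Submodule.smul_mem _ _ ha

theorem Fm_y (m n : ℕ) (u : Weyl R) (hu : u ∈ Fm R m n) : Wy R * u ∈ Fm R m (n + 1) := by
  induction hu using Submodule.span_induction with
  | mem u h =>
    obtain ⟨k, l, hk, hl, rfl⟩ := h
    rw [y_mon]
    exact Submodule.add_mem _ (Submodule.subset_span ⟨k, l + 1, hk, by omega, rfl⟩)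
      (Submodule.smul_mem _ _ (Submodule.subset_span ⟨k - 1, l, by omega, by omega, rfl⟩))
  | zero => simp
  | add a b _ _ ha hb => rw [mul_add]; exact Submodule.add_mem _ ha hb
  | smul r a _ ha => rw [mul_smul_comm]; exact Submodule.smul_mem _ _ ha

theorem Fm_mon (i j m n : ℕ) (u : Weyl R) (hu : u ∈ Fm R m n) :
    mon R i j * u ∈ Fm R (m + i) (n + j) := by
  have h1 : Wy R ^ j * u ∈ Fm R m (n + j) := by
    induction j with
    | zero => simpa using hu
    | succ j ih => rw [pow_succ', mul_assoc]; exact Fm_y _ _ _ ih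
  rw [mon, mul_assoc]
  induction i with
  | zero => simpa using h1
  | succ j ih => rw [pow_succ', mul_assoc]; exact Fm_x _ _ _ ih

theorem Fm_mul {m n m' n' : ℕ} {u v : Weyl R} (hu : u ∈ Fm R m n) (hv : v ∈ Fm R m' n') :
    u * v ∈ Fm R (m + m') (n + n') := by
  induction hu using Submodule.span_induction with
  | mem u h =>
    obtain ⟨k, l, hk, hl, rfl⟩ := h
    exact Fm_mono (by omega) (by omega) (Fm_mon k l _ _ _ hv)
  | zero => simp
  | add a b _ _ ha hb => rw [add_mul]; exact Submodule.add_mem _ ha hb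
  | smul r a _ ha => rw [smul_mul_assoc]; exact Submodule.smul_mem _ _ ha

theorem Fm_pow {m n : ℕ} {u : Weyl R} (hu : u ∈ Fm R m n) (k : ℕ) :
    u ^ k ∈ Fm R (k * m) (k * n) := by
  induction k with
  | zero =>
    rw [pow_zero]
    exact Submodule.subset_span ⟨0, 0, by omega, by omega, by simp [mon]⟩
  | succ k ih => rw [pow_succ, add_mul, add_mul, one_mul, one_mul]; exact Fm_mul ih hu

/-- lexicographic lower part -/
def Lm (R : Type) [CommRing R] (m n : ℕ) : Submodule R (Weyl R) :=
  Submodule.span R {u | ∃ i j, (j < n ∨ (j = n ∧ i < m)) ∧ u = mon R i j}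

theorem mem_Lm_iff (m n : ℕ) (u : Weyl R) :
    u ∈ Lm R m n ↔ ∀ i j, ¬ (j < n ∨ (j = n ∧ i < m)) → cf R u (i, j) = 0 := by
  constructor
  · intro hu i j hij
    induction hu using Submodule.span_induction with
    | mem u h =>
      obtain ⟨k, l, hk, rfl⟩ := h
      rw [cf_mon, Finsupp.single_apply, if_neg]
      rintro ⟨⟩
      exact hij hk
    | zero => simp
    | add a b _ _ ha hb => simp [ha, hb]
    | smul r a _ ha => simp [ha]
  · intro h
    rw [w_sum u]
    refine Submodule.sum_mem _ fun q hq => Submodule.smul_mem _ _ (Submodule.subset_span ?_)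
    refine ⟨q.1, q.2, ?_, rfl⟩
    by_contra hc
    exact Finsupp.mem_support_iff.1 hq (h q.1 q.2 (by omega))

theorem Lm_mono {m n m' n' : ℕ} (h : n < n' ∨ (n = n' ∧ m ≤ m')) : Lm R m n ≤ Lm R m' n' := by
  intro u
  simp only [mem_Lm_iff]
  intro h i j hij
  exact h i j (by omega)

theorem mon_mem_Lm {i j m n : ℕ} (h : j < n ∨ (j = n ∧ i < m)) : mon R i j ∈ Lm R m n :=
  Submodule.subset_span ⟨i, j, h, rfl⟩

theorem ypow_mon (j k l : ℕ) : Wy R ^ j * mon R k l - mon R k (l + j) ∈ Lm R 0 (l + j) := by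
  induction j with
  | zero => simp
  | succ j ih =>
    have hy : ∀ u ∈ Lm R 0 (l + j), Wy R * u ∈ Lm R 0 (l + (j + 1)) := by
      intro u hu
      induction hu using Submodule.span_induction with
      | mem u h =>
        obtain ⟨k, l, hk, rfl⟩ := h
        rw [y_mon]
        exact Submodule.add_mem _ (mon_mem_Lm (by omega))
          (Submodule.smul_mem _ _ (mon_mem_Lm (by omega)))
      | zero => simp
      | add a b _ _ ha hb => rw [mul_add]; exact Submodule.add_mem _ ha hb
      | smul r a _ ha => rw [mul_smul_comm]; exact Submodule.smul_mem _ _ ha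
    have h1 := hy _ ih
    rw [mul_sub, ← mul_assoc, ← pow_succ', y_mon] at h1
    have h2 : (k : R) • mon R (k - 1) (l + j) ∈ Lm R 0 (l + (j + 1)) :=
      Submodule.smul_mem _ _ (mon_mem_Lm (by omega))
    have := Submodule.add_mem _ h1 h2
    convert this using 1
    rw [← add_assoc l]
    abel

theorem mon_mul_mon (i j k l : ℕ) :
    mon R i j * mon R k l - mon R (i + k) (l + j) ∈ Lm R 0 (l + j) := by
  have hx : ∀ u ∈ Lm R 0 (l + j), Wx R ^ i * u ∈ Lm R 0 (l + j) := by
    intro u hu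
    induction hu using Submodule.span_induction with
    | mem u h =>
      obtain ⟨k, l, hk, rfl⟩ := h
      have : Wx R ^ i * mon R k l = mon R (i + k) l := by simp [mon, pow_add, mul_assoc]
      rw [this]
      exact mon_mem_Lm (by omega)
    | zero => simp
    | add a b _ _ ha hb => rw [mul_add]; exact Submodule.add_mem _ ha hb
    | smul r a _ ha => rw [mul_smul_comm]; exact Submodule.smul_mem _ _ ha
  have := hx _ (ypow_mon j k l)
  convert this using 1
  simp [mon, pow_add, mul_assoc, mul_sub]

theorem Lm_mul_mon {m n k l : ℕ} {u : Weyl R} (hu : u ∈ Lm R m n) :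
    u * mon R k l ∈ Lm R (m + k) (n + l) := by
  induction hu using Submodule.span_induction with
  | mem u h =>
    obtain ⟨i, j, hk, rfl⟩ := h
    have h1 := Lm_mono (m' := m + k) (n' := n + l) (by omega) (mon_mul_mon (R := R) i j k l)
    have h2 : mon R (i + k) (l + j) ∈ Lm R (m + k) (n + l) := mon_mem_Lm (by omega)
    simpa using Submodule.add_mem _ h1 h2
  | zero => simp
  | add a b _ _ ha hb => rw [add_mul]; exact Submodule.add_mem _ ha hb
  | smul r a _ ha => rw [smul_mul_assoc]; exact Submodule.smul_mem _ _ ha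

theorem mon_mul_Lm {m n k l : ℕ} {u : Weyl R} (hu : u ∈ Lm R m n) :
    mon R k l * u ∈ Lm R (k + m) (l + n) := by
  induction hu using Submodule.span_induction with
  | mem u h =>
    obtain ⟨i, j, hk, rfl⟩ := h
    have h1 := Lm_mono (m' := k + m) (n' := l + n) (by omega) (mon_mul_mon (R := R) k l i j)
    have h2 : mon R (k + i) (j + l) ∈ Lm R (k + m) (l + n) := mon_mem_Lm (by omega)
    simpa using Submodule.add_mem _ h1 h2
  | zero => simp
  | add a b _ _ ha hb => rw [mul_add]; exact Submodule.add_mem _ ha hb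
  | smul r a _ ha => rw [mul_smul_comm]; exact Submodule.smul_mem _ _ ha

theorem Lm_mul_Lm {m n k l : ℕ} {u v : Weyl R} (hu : u ∈ Lm R m n) (hv : v ∈ Lm R k l) :
    u * v ∈ Lm R (m + k) (n + l) := by
  induction hv using Submodule.span_induction with
  | mem v h =>
    obtain ⟨i, j, hk, rfl⟩ := h
    exact Lm_mono (by omega) (Lm_mul_mon hu)
  | zero => simp
  | add a b _ _ ha hb => rw [mul_add]; exact Submodule.add_mem _ ha hb
  | smul r a _ ha => rw [mul_smul_comm]; exact Submodule.smul_mem _ _ ha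

theorem lead_mul {m n k l : ℕ} {c d : R} {u v : Weyl R} (hu : u - c • mon R m n ∈ Lm R m n)
    (hv : v - d • mon R k l ∈ Lm R k l) :
    u * v - (c * d) • mon R (m + k) (n + l) ∈ Lm R (m + k) (n + l) := by
  have e : u * v - (c * d) • mon R (m + k) (n + l) =
      (u - c • mon R m n) * (v - d • mon R k l) + d • ((u - c • mon R m n) * mon R k l)
      + c • (mon R m n * (v - d • mon R k l))
      + (c * d) • (mon R m n * mon R k l - mon R (m + k) (l + n)) := by
    simp only [sub_mul, mul_sub, smul_sub, smul_mul_assoc, mul_smul_comm, smul_smul, add_comm l n,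
      mul_comm d c]
    abel
  rw [e]
  refine Submodule.add_mem _ (Submodule.add_mem _ (Submodule.add_mem _ (Lm_mul_Lm hu hv)
    (Submodule.smul_mem _ _ (Lm_mul_mon hu))) (Submodule.smul_mem _ _ (mon_mul_Lm hv)))
    (Submodule.smul_mem _ _ (Lm_mono (by omega) (mon_mul_mon m n k l)))

theorem lead_pow {m n : ℕ} {c : R} {u : Weyl R} (hu : u - c • mon R m n ∈ Lm R m n) (p : ℕ) :
    u ^ p - c ^ p • mon R (p * m) (p * n) ∈ Lm R (p * m) (p * n) := by
  induction p with
  | zero => simp [mon]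
  | succ p ih =>
    rw [pow_succ, pow_succ, add_mul, add_mul, one_mul, one_mul]
    exact lead_mul ih hu

theorem lead_pow_cf {m n : ℕ} {c : R} {u : Weyl R} (hu : u - c • mon R m n ∈ Lm R m n) (p : ℕ) :
    cf R (u ^ p) (p * m, p * n) = c ^ p := by
  have := (mem_Lm_iff _ _ _).1 (lead_pow hu p) (p * m) (p * n) (by omega)
  rw [map_sub, map_smul, cf_mon] at this
  simpa [sub_eq_zero] using this

end degs
end WD
namespace WD
open MulOpposite
section parity
variable {R : Type} [CommRing R]

theorem bt_rel {B : Type} [Ring B] {x y : B} (h : y * x = x * y + 1) :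
    op (-y) * op x = op x * op (-y) + 1 := by
  rw [← op_mul, ← op_mul, ← op_one, ← op_add, neg_mul, h]
  congr 1
  noncomm_ring

theorem bt_pow {B : Type} [Ring B] [Algebra R B] {x y : B} (j : ℕ) (h : y ^ j * x = x * y ^ j) :
    (-y) ^ j * x = (-1 : R) ^ j • (x * y ^ j) := by
  rw [neg_pow, mul_assoc, h, Algebra.smul_def]
  simp

/-- the anti-automorphism x ↦ x, y ↦ -y -/
def bt (R : Type) [CommRing R] : Weyl R →ₐ[R] (Weyl R)ᵐᵒᵖ :=
  wlift (op (Wx R)) (op (-Wy R)) (bt_rel (wrel R))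

theorem bt_x : bt R (Wx R) = op (Wx R) := by simp [bt]
theorem bt_y : bt R (Wy R) = op (-Wy R) := by simp [bt]

theorem bt_mon {p : ℕ} (h0 : (p : R) = 0) (i j : ℕ) (hi : p ∣ i) :
    bt R (mon R i j) = op ((-1 : R) ^ j • mon R i j) := by
  obtain ⟨k, rfl⟩ := hi
  have hc := Subring.mem_center_iff.1 (Subring.pow_mem _ (xp_central (R := R) h0) k) (Wy R ^ j)
  rw [mon, map_mul, map_pow, map_pow, bt_x, bt_y, ← op_pow, ← op_pow, ← op_mul, pow_mul]
  exact congrArg op (bt_pow j hc)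

theorem parity {p : ℕ} (h0 : (p : R) = 0) (u : Weyl R) (ε : R)
    (hu : ∀ i j, ¬ (p ∣ i ∧ p ∣ j) → cf R u (i, j) = 0) (hb : bt R u = op (ε • u)) (i j : ℕ) :
    (-1) ^ j * cf R u (i, j) = ε * cf R u (i, j) := by
  have h1 : cf R (unop (bt R u)) (i, j) = (-1) ^ j * cf R u (i, j) := by
    have e : bt R u = op (∑ q ∈ (cf R u).support, (cf R u q * (-1) ^ q.2) • mon R q.1 q.2) := by
      conv_lhs => rw [w_sum u]
      rw [Finsupp.sum, map_sum, Finset.op_sum]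
      refine Finset.sum_congr rfl fun q hq => ?_
      have hq' : p ∣ q.1 := by
        by_contra hc
        exact Finsupp.mem_support_iff.1 hq (hu q.1 q.2 (fun h => hc h.1))
      rw [map_smul, bt_mon h0 _ _ hq', ← op_smul, smul_smul]
    rw [e, unop_op, map_sum]
    simp only [map_smul, cf_mon, Finsupp.coe_finsetSum, Finset.sum_apply, Finsupp.smul_apply,
      Finsupp.single_apply]
    rw [Finset.sum_eq_single (i, j)]
    · simp [mul_comm]
    · intro q _ hq
      simp [hq]
    · intro h
      simp only [Finsupp.mem_support_iff, not_not] at h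
      simp [h]
  rw [← h1, hb]
  simp

end parity

section jac

theorem ad_pow {B : Type} [Ring B] {s a : B} (h : a * s = s * a + 1) (k r : ℕ) :
    ((LinearMap.mulLeft ℤ a - LinearMap.mulRight ℤ a) ^ r) (s ^ k)
      = (k.descFactorial r : B) * s ^ (k - r) := by
  induction r with
  | zero => simp
  | succ r ih =>
    rw [pow_succ', Module.End.mul_apply, ih]
    simp only [LinearMap.sub_apply, LinearMap.mulLeft_apply, LinearMap.mulRight_apply]
    rw [← mul_assoc, ← Nat.cast_comm, mul_assoc, comm_pow_x h, Nat.descFactorial_succ]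
    push_cast
    rw [Nat.sub_sub]
    have : ((k - r : ℕ) : B) * (k.descFactorial r : B) = (k.descFactorial r : B) * ((k - r : ℕ) : B) :=
      Nat.cast_comm _ _
    rw [this]
    noncomm_ring

theorem pw_comm {B : Type} [Ring B] {p : ℕ} (hp : p.Prime) (hB : ((p * p : ℕ) : B) = 0) {s a : B}
    (h : a * s = s * a + 1) : a ^ p * s ^ p = s ^ p * a ^ p + (p.factorial : B) := by
  set L := LinearMap.mulLeft ℤ a
  set Rr := LinearMap.mulRight ℤ a
  have hc : Commute Rr (L - Rr) := by
    refine Commute.sub_right ?_ (Commute.refl _)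
    exact (LinearMap.commute_mulLeft_right (R := ℤ) a a).symm
  have e1 : L ^ p = ∑ m ∈ Finset.range (p + 1), Rr ^ m * (L - Rr) ^ (p - m) * (p.choose m : Module.End ℤ B) := by
    rw [← hc.add_pow]; congr 1; abel
  have e2 : a ^ p * s ^ p = (L ^ p) (s ^ p) := by
    simp only [L]; rw [LinearMap.pow_mulLeft]; rfl
  have e3 : ∀ m ≤ p, (Rr ^ m * (L - Rr) ^ (p - m) * (p.choose m : Module.End ℤ B)) (s ^ p)
      = ((p.choose m * p.descFactorial (p - m) : ℕ) : B) * (s ^ m * a ^ m) := by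
    intro m hm
    rw [Module.End.mul_apply, Module.End.mul_apply, Module.End.natCast_apply, map_nsmul, map_nsmul,
      ad_pow h]
    simp only [Rr]; rw [LinearMap.pow_mulRight]
    rw [LinearMap.mulRight_apply, Nat.sub_sub_self hm]
    push_cast
    rw [nsmul_eq_mul]
    noncomm_ring
  rw [e2, e1, LinearMap.sum_apply, Finset.sum_congr rfl
    (fun m hm => e3 m (by have := Finset.mem_range.1 hm; omega)),
    Finset.sum_range_succ]
  obtain ⟨n, rfl⟩ : ∃ n, p = n + 1 := ⟨p - 1, by have := hp.pos; omega⟩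
  rw [Finset.sum_range_succ', Finset.sum_eq_zero]
  · have hd : (n + 1).descFactorial n = (n + 1).factorial := by
      have h1 := Nat.descFactorial_succ (n + 1) n
      rw [Nat.descFactorial_self] at h1
      simpa using h1.symm
    simp [hd, add_comm]
  · intro m hm
    have hm := Finset.mem_range.1 hm
    have d1 : (n + 1) ∣ (n + 1).choose (m + 1) :=
      hp.dvd_choose_self (by omega) (by omega)
    have d2 : (n + 1) ∣ (n + 1).descFactorial (n + 1 - (m + 1)) := by
      obtain ⟨t, ht⟩ : ∃ t, n + 1 - (m + 1) = t + 1 := ⟨n - m - 1, by omega⟩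
      rw [ht, Nat.succ_descFactorial_succ]
      exact dvd_mul_right _ _
    obtain ⟨c, hc⟩ := mul_dvd_mul d1 d2
    rw [hc, Nat.cast_mul, hB, zero_mul, zero_mul]

variable {R : Type} [CommRing R]

theorem e_comm1 {B : Type} [Ring B] [Algebra R B] {X Y : B} {e : R} (h : Y * X = X * Y + e • 1)
    (k : ℕ) : Y * X ^ k = X ^ k * Y + ((k : R) * e) • X ^ (k - 1) := by
  induction k with
  | zero => simp
  | succ k ih =>
    rw [pow_succ, ← mul_assoc, ih, add_mul, mul_assoc (X ^ k), h, mul_add, smul_mul_assoc]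
    rcases k with _ | k
    · simp
    · simp only [Nat.add_sub_cancel]
      rw [← pow_succ, mul_smul_comm, mul_one, mul_assoc, add_assoc, ← add_smul]
      congr 2
      push_cast; ring

theorem e_comm {B : Type} [Ring B] [Algebra R B] {X Y : B} {e : R} (h : Y * X = X * Y + e • 1)
    (he : e * e = 0) (j k : ℕ) :
    Y ^ j * X ^ k = X ^ k * Y ^ j + ((j : R) * k * e) • (X ^ (k - 1) * Y ^ (j - 1)) := by
  induction j with
  | zero => simp
  | succ j ih =>
    rw [pow_succ', mul_assoc, ih, mul_add, ← mul_assoc, e_comm1 h, mul_smul_comm, ← mul_assoc Y,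
      e_comm1 h, add_mul, add_mul, smul_add, smul_mul_assoc, smul_mul_assoc, smul_smul]
    have : (j : R) * k * e * (((k - 1 : ℕ) : R) * e) = 0 := by
      calc _ = (j : R) * k * ((k - 1 : ℕ) : R) * (e * e) := by ring
        _ = 0 := by rw [he, mul_zero]
    rw [this, zero_smul, add_zero, Nat.add_sub_cancel, mul_assoc (X ^ k), ← pow_succ', add_assoc]
    congr 1
    rcases j with _ | j
    · simp
    · rw [mul_assoc (X ^ (k - 1)), Nat.add_sub_cancel, ← pow_succ', ← add_smul]
      congr 1
      push_cast; ring

theorem e_brak {B : Type} [Ring B] [Algebra R B] {X Y : B} {e : R} (h : Y * X = X * Y + e • 1)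
    (he : e * e = 0) (i j k l : ℕ) :
    (X ^ i * Y ^ j) * (X ^ k * Y ^ l) - (X ^ k * Y ^ l) * (X ^ i * Y ^ j)
     = (e * ((j : R) * k - i * l)) • (X ^ (i + k - 1) * Y ^ (j + l - 1)) := by
  have key : ∀ i j k l : ℕ, (X ^ i * Y ^ j) * (X ^ k * Y ^ l) = X ^ (i + k) * Y ^ (j + l) +
      (e * ((j : R) * k)) • (X ^ (i + k - 1) * Y ^ (j + l - 1)) := by
    intro i j k l
    rw [mul_assoc, ← mul_assoc (Y ^ j), e_comm h he, add_mul, mul_add, smul_mul_assoc, mul_smul_comm,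
      mul_assoc, ← pow_add, ← mul_assoc, ← pow_add, mul_assoc (X ^ (k - 1)), ← pow_add, ← mul_assoc,
      ← pow_add]
    congr 1
    rcases Nat.eq_zero_or_pos j with rfl | hj
    · simp
    rcases Nat.eq_zero_or_pos k with rfl | hk
    · simp
    rw [show i + (k - 1) = i + k - 1 by omega, show j - 1 + l = j + l - 1 by omega]
    congr 1; ring
  rw [key, key, add_comm k i, add_comm l j, add_sub_add_left_eq_sub, ← sub_smul]
  congr 1; ring

theorem lift_mul (p : ℕ) (v : Weyl R) (hv : ∀ q, ∃ t, cf R v q = (p : R) * t) :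
    ∃ u, v = (p : R) • u := by
  choose t ht using hv
  refine ⟨∑ q ∈ (cf R v).support, t q • mon R q.1 q.2, ?_⟩
  conv_lhs => rw [w_sum v]
  rw [Finsupp.sum, Finset.smul_sum]
  refine Finset.sum_congr rfl fun q _ => ?_
  rw [smul_smul, ht]

theorem p_mon_central {p : ℕ} (h0 : (p : R) * p = 0) (k l : ℕ) :
    (p : R) • mon R (p * k) (p * l) ∈ Subring.center (Weyl R) := by
  refine commute_of_gens _ ?_ ?_
  · change _ * _ = _ * _
    rw [smul_mul_assoc, mon_x, mul_smul_comm, smul_add, smul_smul]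
    have : (p : R) * ((p * l : ℕ) : R) = 0 := by push_cast; rw [← mul_assoc, h0, zero_mul]
    rw [this, zero_smul, add_zero]
    congr 1
    simp [mon, pow_succ', mul_assoc]
  · change _ * _ = _ * _
    rw [smul_mul_assoc, mul_smul_comm, y_mon, smul_add, smul_smul]
    have : (p : R) * ((p * k : ℕ) : R) = 0 := by push_cast; rw [← mul_assoc, h0, zero_mul]
    rw [this, zero_smul, add_zero]
    congr 1
    simp [mon, pow_succ, mul_assoc]

theorem decomp {p : ℕ} (hp : p.Prime) (D : Finset (ℕ × ℕ)) (S : Weyl R)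
    (h1 : ∀ i j, ¬ (p ∣ i ∧ p ∣ j) → ∃ t, cf R S (i, j) = (p : R) * t)
    (h2 : ∀ q, q ∉ D → cf R S (p * q.1, p * q.2) = 0) :
    ∃ u, S = ∑ q ∈ D, cf R S (p * q.1, p * q.2) • mon R (p * q.1) (p * q.2) + (p : R) • u := by
  set T := ∑ q ∈ D, cf R S (p * q.1, p * q.2) • mon R (p * q.1) (p * q.2) with hT
  obtain ⟨u, hu⟩ := lift_mul p (S - T) (by
    rintro ⟨i, j⟩
    have hTc : cf R T (i, j) = ∑ q ∈ D, if (p * q.1, p * q.2) = (i, j) then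
        cf R S (p * q.1, p * q.2) else 0 := by
      rw [hT, map_sum]
      simp only [map_smul, cf_mon, Finsupp.coe_finsetSum, Finset.sum_apply, Finsupp.smul_apply,
        Finsupp.single_apply, smul_eq_mul, mul_ite, mul_one, mul_zero]
    rw [map_sub, Finsupp.sub_apply, hTc]
    by_cases hd : p ∣ i ∧ p ∣ j
    · obtain ⟨⟨k, rfl⟩, ⟨l, rfl⟩⟩ := hd
      refine ⟨0, ?_⟩
      rw [mul_zero, sub_eq_zero]
      by_cases hD : (k, l) ∈ D
      · rw [Finset.sum_eq_single_of_mem _ hD]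
        · simp
        · intro q _ hq
          rw [if_neg]
          intro he
          simp only [Prod.mk.injEq, mul_eq_mul_left_iff, hp.ne_zero, or_false] at he
          exact hq (Prod.ext he.1 he.2)
      · rw [h2 (k, l) hD]
        symm
        refine Finset.sum_eq_zero fun q hq => ?_
        rw [if_neg]
        intro he
        simp only [Prod.mk.injEq, mul_eq_mul_left_iff, hp.ne_zero, or_false] at he
        exact hD (by rw [← he.1, ← he.2]; exact hq)
    · rw [Finset.sum_eq_zero, sub_zero]
      · exact h1 i j hd
      · intro q _
        rw [if_neg]
        rintro ⟨⟩
        exact hd ⟨dvd_mul_right _ _, dvd_mul_right _ _⟩)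
  exact ⟨u, by rw [← hu]; abel⟩

/-- the jacobian identity -/
theorem jac {p : ℕ} (hp : p.Prime) (h0 : (p : R) * p = 0) (D : Finset (ℕ × ℕ)) (S A : Weyl R)
    (hAS : A * S = S * A + (p.factorial : Weyl R))
    (hS1 : ∀ i j, ¬ (p ∣ i ∧ p ∣ j) → ∃ t, cf R S (i, j) = (p : R) * t)
    (hS2 : ∀ q, q ∉ D → cf R S (p * q.1, p * q.2) = 0)
    (hA1 : ∀ i j, ¬ (p ∣ i ∧ p ∣ j) → ∃ t, cf R A (i, j) = (p : R) * t)
    (hA2 : ∀ q, q ∉ D → cf R A (p * q.1, p * q.2) = 0) (M N : ℕ) :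
    (p.factorial : R) * (∑ q ∈ D, ∑ r ∈ D, if q.1 + r.1 = M + 1 ∧ q.2 + r.2 = N + 1 then
      ((q.2 : R) * r.1 - q.1 * r.2) * cf R A (p * q.1, p * q.2) * cf R S (p * r.1, p * r.2) else 0)
     = (p.factorial : R) * (if M = 0 ∧ N = 0 then 1 else 0) := by
  obtain ⟨u, hu⟩ := decomp hp D S hS1 hS2
  obtain ⟨v, hv⟩ := decomp hp D A hA1 hA2
  set s : ℕ × ℕ → R := fun q => cf R S (p * q.1, p * q.2) with hs
  set a : ℕ × ℕ → R := fun q => cf R A (p * q.1, p * q.2) with ha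
  set T := ∑ q ∈ D, s q • mon R (p * q.1) (p * q.2) with hT
  set P := ∑ q ∈ D, a q • mon R (p * q.1) (p * q.2) with hP
  have hcen : ∀ c : ℕ × ℕ → R, ∀ g : Weyl R,
      g * ((p : R) • ∑ q ∈ D, c q • mon R (p * q.1) (p * q.2)) =
      ((p : R) • ∑ q ∈ D, c q • mon R (p * q.1) (p * q.2)) * g := by
    intro c g
    rw [Finset.smul_sum, Finset.sum_mul, Finset.mul_sum]
    refine Finset.sum_congr rfl fun q _ => ?_
    rw [smul_comm, mul_smul_comm, smul_mul_assoc,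
      Subring.mem_center_iff.1 (p_mon_central h0 q.1 q.2) g]
  have hT' := hcen s v
  have hP' := hcen a u
  rw [← hT] at hT'
  rw [← hP] at hP'
  simp only [mul_smul_comm, smul_mul_assoc] at hT' hP'
  have hPT : P * T - T * P = (p.factorial : R) • 1 := by
    have e : A * S - S * A = P * T - T * P := by
      rw [hu, hv]
      simp only [add_mul, mul_add, smul_mul_assoc, mul_smul_comm, smul_add, smul_smul, h0, zero_smul,
        hT', hP']
      abel
    rw [← e, hAS, add_sub_cancel_left, Algebra.smul_def]; simp
  set X := Wx R ^ p
  set Y := Wy R ^ p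
  have hYX : Y * X = X * Y + (p.factorial : R) • (1 : Weyl R) := by
    have := pw_comm (B := Weyl R) hp (w_cast (by push_cast; exact h0)) (wrel R)
    simp only [X, Y]; rw [this, Algebra.smul_def]; simp
  have hee : (p.factorial : R) * (p.factorial : R) = 0 := by
    obtain ⟨c, hc⟩ := Nat.dvd_factorial hp.pos le_rfl
    rw [hc]; push_cast
    calc _ = (p : R) * p * (c * c) := by ring
      _ = 0 := by rw [h0, zero_mul]
  have hm : ∀ i j, mon R (p * i) (p * j) = X ^ i * Y ^ j := by
    intro i j; simp only [mon, X, Y, pow_mul]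
  have hPT2 : P * T - T * P = ∑ q ∈ D, ∑ r ∈ D, (a q * s r *
      ((p.factorial : R) * ((q.2 : R) * r.1 - q.1 * r.2))) •
        mon R (p * (q.1 + r.1 - 1)) (p * (q.2 + r.2 - 1)) := by
    have e1 : P * T = ∑ q ∈ D, ∑ r ∈ D, (a q * s r) •
        (mon R (p * q.1) (p * q.2) * mon R (p * r.1) (p * r.2)) := by
      rw [hP, hT, Finset.sum_mul_sum]
      simp only [smul_mul_smul_comm]
    have e2 : T * P = ∑ q ∈ D, ∑ r ∈ D, (a q * s r) •
        (mon R (p * r.1) (p * r.2) * mon R (p * q.1) (p * q.2)) := by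
      rw [hP, hT, Finset.sum_mul_sum, Finset.sum_comm]
      simp only [smul_mul_smul_comm, mul_comm (s _)]
    rw [e1, e2, ← Finset.sum_sub_distrib]
    refine Finset.sum_congr rfl fun q _ => ?_
    rw [← Finset.sum_sub_distrib]
    refine Finset.sum_congr rfl fun r _ => ?_
    refine (smul_sub (a q * s r) (mon R (p * q.1) (p * q.2) * mon R (p * r.1) (p * r.2))
      (mon R (p * r.1) (p * r.2) * mon R (p * q.1) (p * q.2))).symm.trans ?_
    simp only [hm]
    rw [mul_smul (a q * s r)]
    exact congrArg (fun w => (a q * s r) • w) (e_brak hYX hee _ _ _ _)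
  have hfin := congrArg (fun w => cf R w (p * M, p * N)) (hPT2.symm.trans hPT)
  have h1 : cf R (1 : Weyl R) = Finsupp.single (0, 0) 1 := by
    rw [← cf_mon]; simp [mon]
  simp only [map_sum, map_smul, cf_mon, h1, Finsupp.coe_finsetSum, Finset.sum_apply,
    Finsupp.smul_apply, Finsupp.single_apply, smul_eq_mul, Prod.mk.injEq] at hfin
  have h2 : (0 = p * M ∧ 0 = p * N) ↔ (M = 0 ∧ N = 0) := by
    constructor
    · rintro ⟨h, h'⟩
      have := hp.pos
      constructor <;> nlinarith
    · rintro ⟨rfl, rfl⟩; simp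
  rw [if_congr h2 rfl rfl] at hfin
  rw [← hfin, Finset.mul_sum]
  refine Finset.sum_congr rfl fun q _ => ?_
  rw [Finset.mul_sum]
  refine Finset.sum_congr rfl fun r _ => ?_
  by_cases hz : q.2 * r.1 = q.1 * r.2
  · have : (q.2 : R) * r.1 - q.1 * r.2 = 0 := by
      rw [sub_eq_zero, ← Nat.cast_mul, ← Nat.cast_mul, hz]
    rw [this]; simp
  · have hpos : 0 < q.1 + r.1 ∧ 0 < q.2 + r.2 := by
      constructor
      · by_contra hc
        apply hz
        rw [show q.1 = 0 by omega, show r.1 = 0 by omega]; simp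
      · by_contra hc
        apply hz
        rw [show q.2 = 0 by omega, show r.2 = 0 by omega]; simp
    have h3 : (p * (q.1 + r.1 - 1) = p * M ∧ p * (q.2 + r.2 - 1) = p * N) ↔
        (q.1 + r.1 = M + 1 ∧ q.2 + r.2 = N + 1) := by
      rw [Nat.mul_right_inj hp.ne_zero, Nat.mul_right_inj hp.ne_zero]; omega
    rw [if_congr h3 rfl rfl]
    split_ifs
    · simp only [hs, ha]; ring
    · simp

end jac
end WD
namespace WD
section commlemma
variable {κ : Type} [CommRing κ] [IsDomain κ]

theorem extremal (D : Finset (ℕ × ℕ)) (a s : ℕ × ℕ → κ)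
    (ha : ∀ q, q ∉ D → a q = 0) (hs : ∀ q, q ∉ D → s q = 0)
    (hJ : ∀ M N : ℕ, (∑ q ∈ D, ∑ r ∈ D, if q.1 + r.1 = M + 1 ∧ q.2 + r.2 = N + 1 then
      ((q.2 : κ) * r.1 - q.1 * r.2) * a q * s r else 0) = if M = 0 ∧ N = 0 then 1 else 0)
    (q0 r0 : ℕ × ℕ) (hq0 : a q0 ≠ 0) (hr0 : s r0 ≠ 0)
    (hun : ∀ q r, a q ≠ 0 → s r ≠ 0 → q.1 + r.1 = q0.1 + r0.1 → q.2 + r.2 = q0.2 + r0.2 →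
      q = q0 ∧ r = r0)
    (hd : ((q0.2 : κ) * r0.1 - q0.1 * r0.2) ≠ 0) : q0.1 + r0.1 = 1 ∧ q0.2 + r0.2 = 1 := by
  have h1 : 0 < q0.1 + r0.1 := by
    by_contra hc
    apply hd
    rw [show q0.1 = 0 by omega, show r0.1 = 0 by omega]; simp
  have h2 : 0 < q0.2 + r0.2 := by
    by_contra hc
    apply hd
    rw [show q0.2 = 0 by omega, show r0.2 = 0 by omega]; simp
  have h := hJ (q0.1 + r0.1 - 1) (q0.2 + r0.2 - 1)
  rw [Nat.sub_add_cancel h1, Nat.sub_add_cancel h2] at h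
  have hq : q0 ∈ D := by by_contra hc; exact hq0 (ha _ hc)
  have hr : r0 ∈ D := by by_contra hc; exact hr0 (hs _ hc)
  rw [Finset.sum_eq_single_of_mem q0 hq, Finset.sum_eq_single_of_mem r0 hr, if_pos ⟨rfl, rfl⟩] at h
  · by_contra hc
    rw [if_neg (by omega)] at h
    exact mul_ne_zero (mul_ne_zero hd hq0) hr0 h
  · intro r _ hne
    split_ifs with hif
    · by_contra hz
      have := hun q0 r hq0 (fun h0 => hz (by rw [h0, mul_zero])) hif.1 hif.2
      exact hne this.2
    · rfl
  · intro q _ hne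
    refine Finset.sum_eq_zero fun r _ => ?_
    split_ifs with hif
    · by_contra hz
      have := hun q r (fun h0 => hz (by rw [h0, mul_zero, zero_mul]))
        (fun h0 => hz (by rw [h0, mul_zero])) hif.1 hif.2
      exact hne this.1
    · rfl

theorem comm_lemma (p N₁ N₂ : ℕ) [CharP κ p] (hN : N₁ + N₂ < p)
    (D : Finset (ℕ × ℕ)) (a s : ℕ × ℕ → κ)
    (ha : ∀ q, q ∉ D → a q = 0) (hs : ∀ q, q ∉ D → s q = 0)
    (hao : ∀ q, a q ≠ 0 → Odd q.2) (hse : ∀ q, s q ≠ 0 → Even q.2)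
    (hab : ∀ q, a q ≠ 0 → q.2 ≤ N₁) (hsb : ∀ q, s q ≠ 0 → q.1 ≤ N₂)
    (hJ : ∀ M N : ℕ, (∑ q ∈ D, ∑ r ∈ D, if q.1 + r.1 = M + 1 ∧ q.2 + r.2 = N + 1 then
      ((q.2 : κ) * r.1 - q.1 * r.2) * a q * s r else 0) = if M = 0 ∧ N = 0 then 1 else 0) :
    ∀ q, a q ≠ 0 → q = (0, 1) := by
  have hcast : ∀ n : ℕ, 0 < n → n < p → (n : κ) ≠ 0 := by
    intro n h0 hn h
    have := (CharP.cast_eq_zero_iff κ p n).1 h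
    exact absurd (Nat.le_of_dvd h0 this) (by omega)
  have haD : ∀ q, a q ≠ 0 → q ∈ D := fun q h => by by_contra hc; exact h (ha _ hc)
  have hsD : ∀ q, s q ≠ 0 → q ∈ D := fun q h => by by_contra hc; exact h (hs _ hc)
  -- existence
  obtain ⟨h01, h10⟩ : a (0, 1) ≠ 0 ∧ s (1, 0) ≠ 0 := by
    have h := hJ 0 0
    rw [if_pos ⟨rfl, rfl⟩] at h
    obtain ⟨q, hq, hq'⟩ := Finset.exists_ne_zero_of_sum_ne_zero (by rw [h]; exact one_ne_zero)
    obtain ⟨r, hr, hr'⟩ := Finset.exists_ne_zero_of_sum_ne_zero hq'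
    split_ifs at hr' with hif
    · have haq : a q ≠ 0 := fun h0 => hr' (by rw [h0, mul_zero, zero_mul])
      have hsr : s r ≠ 0 := fun h0 => hr' (by rw [h0, mul_zero])
      have hd : ((q.2 : κ) * r.1 - q.1 * r.2) ≠ 0 := fun h0 => hr' (by rw [h0, zero_mul, zero_mul])
      obtain ⟨q1, q2⟩ := q
      obtain ⟨r1, r2⟩ := r
      have ho := hao _ haq
      simp only at hif ho hd
      have e1 : q2 = 1 := by have := ho.pos; omega
      have e2 : r2 = 0 := by omega
      subst e1; subst e2
      have e3 : r1 ≠ 0 := by rintro rfl; simp at hd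
      have e4 : r1 = 1 := by omega
      have e5 : q1 = 0 := by omega
      subst e4; subst e5
      exact ⟨haq, hsr⟩
    · exact absurd rfl hr'
  -- bottom row
  have hrow : (∀ i, a (i, 1) ≠ 0 → i = 0) ∧ (∀ k, s (k, 0) ≠ 0 → k ≤ 1) := by
    classical
    obtain ⟨q0, hq0, hq0m⟩ := Finset.exists_max_image (D.filter fun q => a q ≠ 0 ∧ q.2 = 1)
      (fun q => q.1) ⟨(0, 1), by simp [h01, haD _ h01]⟩
    obtain ⟨r0, hr0, hr0m⟩ := Finset.exists_max_image (D.filter fun q => s q ≠ 0 ∧ q.2 = 0)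
      (fun q => q.1) ⟨(1, 0), by simp [h10, hsD _ h10]⟩
    simp only [Finset.mem_filter] at hq0 hr0 hq0m hr0m
    have hk1 : 1 ≤ r0.1 := hr0m (1, 0) ⟨hsD _ h10, h10, rfl⟩
    have := extremal D a s ha hs hJ q0 r0 hq0.2.1 hr0.2.1 (by
      intro q r hq hr e1 e2
      have ho := (hao _ hq).pos
      have f1 : q.2 = 1 := by omega
      have f2 : r.2 = 0 := by omega
      have g1 := hq0m q ⟨haD _ hq, hq, f1⟩
      have g2 := hr0m r ⟨hsD _ hr, hr, f2⟩
      exact ⟨Prod.ext (by omega) (by omega), Prod.ext (by omega) (by omega)⟩) (by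
      rw [hq0.2.2, hr0.2.2]
      simp only [Nat.cast_one, one_mul, Nat.cast_zero, mul_zero, sub_zero]
      exact hcast _ hk1 (by have := hsb _ hr0.2.1; omega))
    refine ⟨fun i hi => ?_, fun k hk => ?_⟩
    · have := hq0m (i, 1) ⟨haD _ hi, hi, rfl⟩
      simp only at this; omega
    · have := hr0m (k, 0) ⟨hsD _ hk, hk, rfl⟩
      simp only at this; omega
  -- main
  by_contra! hcon
  obtain ⟨qb, hqb, hqb'⟩ := hcon
  have hqb3 : 3 ≤ qb.2 := by
    obtain ⟨t, ht⟩ := hao _ hqb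
    by_contra hlt
    have h1 : qb.2 = 1 := by omega
    have h2 : qb.1 = 0 := hrow.1 _ (by rw [← h1]; exact hqb)
    exact hqb' (Prod.ext h2 h1)
  classical
  set T : Finset ℚ := ((D.filter fun q => a q ≠ 0 ∧ 3 ≤ q.2).image
      fun q => (q.1 : ℚ) / ((q.2 : ℚ) - 1)) ∪
    ((D.filter fun r => s r ≠ 0 ∧ 2 ≤ r.2).image fun r => ((r.1 : ℚ) - 1) / (r.2 : ℚ)) with hT
  have hTne : T.Nonempty := ⟨_, Finset.mem_union_left _ (Finset.mem_image_of_mem _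
    (Finset.mem_filter.2 ⟨haD _ hqb, hqb, hqb3⟩))⟩
  obtain ⟨τ, hτ, hτm⟩ := T.exists_max_image id hTne
  simp only [id] at hτm
  have hA : ∀ q, a q ≠ 0 → (q.1 : ℚ) ≤ τ * ((q.2 : ℚ) - 1) := by
    intro q hq
    by_cases h3 : 3 ≤ q.2
    · have := hτm _ (Finset.mem_union_left _ (Finset.mem_image_of_mem _
        (Finset.mem_filter.2 ⟨haD _ hq, hq, h3⟩)))
      have hpos : (0 : ℚ) < (q.2 : ℚ) - 1 := by
        have : (3 : ℚ) ≤ q.2 := by exact_mod_cast h3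
        linarith
      exact (div_le_iff₀ hpos).1 this
    · have h1 : q.2 = 1 := by obtain ⟨t, ht⟩ := hao _ hq; omega
      have h2 : q.1 = 0 := hrow.1 _ (by rw [← h1]; exact hq)
      rw [h1, h2]; simp
  have hS : ∀ r, s r ≠ 0 → (r.1 : ℚ) - 1 ≤ τ * (r.2 : ℚ) := by
    intro r hr
    by_cases h3 : 2 ≤ r.2
    · have := hτm _ (Finset.mem_union_right _ (Finset.mem_image_of_mem _
        (Finset.mem_filter.2 ⟨hsD _ hr, hr, h3⟩)))
      have hpos : (0 : ℚ) < (r.2 : ℚ) := by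
        have : (2 : ℚ) ≤ r.2 := by exact_mod_cast h3
        linarith
      exact (div_le_iff₀ hpos).1 this
    · have h1 : r.2 = 0 := by obtain ⟨t, ht⟩ := hse _ hr; omega
      have h2 : r.1 ≤ 1 := hrow.2 _ (by rw [← h1]; exact hr)
      have : (r.1 : ℚ) ≤ 1 := by exact_mod_cast h2
      rw [h1]; simp [this]
  have hτ0 : 0 ≤ τ := by
    have h1 := hA _ hqb
    have h2 : (3 : ℚ) ≤ qb.2 := by exact_mod_cast hqb3
    have h3 : (0 : ℚ) ≤ qb.1 := by positivity
    nlinarith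
  obtain ⟨q0, hq0, hq0m⟩ := Finset.exists_max_image
    (D.filter fun q => a q ≠ 0 ∧ (q.1 : ℚ) = τ * ((q.2 : ℚ) - 1))
    (fun q => q.2) ⟨(0, 1), by simp [h01, haD _ h01]⟩
  obtain ⟨r0, hr0, hr0m⟩ := Finset.exists_max_image
    (D.filter fun q => s q ≠ 0 ∧ (q.1 : ℚ) - 1 = τ * (q.2 : ℚ))
    (fun q => q.2) ⟨(1, 0), by simp [h10, hsD _ h10]⟩
  simp only [Finset.mem_filter] at hq0 hr0 hq0m hr0m
  obtain ⟨_, hq0a, hq0e⟩ := hq0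
  obtain ⟨_, hr0s, hr0e⟩ := hr0
  have hj1 : 1 ≤ q0.2 := (hao _ hq0a).pos
  have hk1 : 1 ≤ r0.1 := by
    have : (0 : ℚ) ≤ τ * r0.2 := by positivity
    have : (1 : ℚ) ≤ r0.1 := by linarith
    exact_mod_cast this
  have hdet : q0.2 * r0.1 = q0.1 * r0.2 + (q0.2 + r0.1 - 1) := by
    have : (q0.2 : ℚ) * r0.1 + 1 = q0.1 * r0.2 + (q0.2 + r0.1) := by
      have : (r0.1 : ℚ) = τ * r0.2 + 1 := by linarith
      rw [hq0e, this]; ring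
    have : q0.2 * r0.1 + 1 = q0.1 * r0.2 + (q0.2 + r0.1) := by exact_mod_cast this
    omega
  have hfin := extremal D a s ha hs hJ q0 r0 hq0a hr0s (by
    intro q r hq hr e1 e2
    have f1 := hA q hq
    have f2 := hS r hr
    have e1' : (q.1 : ℚ) + r.1 = q0.1 + r0.1 := by exact_mod_cast e1
    have e2' : (q.2 : ℚ) + r.2 = q0.2 + r0.2 := by exact_mod_cast e2
    have e3 : τ * ((q.2 : ℚ) + r.2) = τ * (q0.2 + r0.2) := by rw [e2']
    have m1 : (q.1 : ℚ) = τ * ((q.2 : ℚ) - 1) := by linarith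
    have g1 := hq0m q ⟨haD _ hq, hq, m1⟩
    have g2 := hr0m r ⟨hsD _ hr, hr, by linarith⟩
    have k1 : q.2 = q0.2 := by omega
    have k2 : r.2 = r0.2 := by omega
    have k3 : q.1 = q0.1 := by
      have : (q.1 : ℚ) = q0.1 := by rw [m1, hq0e, k1]
      exact_mod_cast this
    exact ⟨Prod.ext k3 k1, Prod.ext (by omega) k2⟩) (by
    have : (q0.2 : κ) * r0.1 - q0.1 * r0.2 = ((q0.2 + r0.1 - 1 : ℕ) : κ) := by
      rw [← Nat.cast_mul, hdet]; push_cast; ring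
    rw [this]
    exact hcast _ (by omega) (by have := hab _ hq0a; have := hsb _ hr0s; omega))
  rw [hT, Finset.mem_union, Finset.mem_image, Finset.mem_image] at hτ
  rcases hτ with ⟨q, hq, hqe⟩ | ⟨r, hr, hre⟩
  · rw [Finset.mem_filter] at hq
    have hpos : ((q.2 : ℚ) - 1) ≠ 0 := by
      have : (3 : ℚ) ≤ q.2 := by exact_mod_cast hq.2.2
      linarith
    have := hq0m q ⟨hq.1, hq.2.1, by rw [← hqe]; field_simp⟩
    have := hq.2.2
    omega
  · rw [Finset.mem_filter] at hr
    have hpos : (r.2 : ℚ) ≠ 0 := by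
      have : (2 : ℚ) ≤ r.2 := by exact_mod_cast hr.2.2
      linarith
    have := hr0m r ⟨hr.1, hr.2.1, by rw [← hre]; field_simp⟩
    have := hr.2.2
    omega

end commlemma
end WD
namespace WD
open MulOpposite
section reduce
variable {R : Type} [CommRing R]

theorem bt_bc (R R' : Type) [CommRing R] [CommRing R'] [Algebra R R'] (u : Weyl R) :
    bt R' (bc R R' u) = op (bc R R' (unop (bt R u))) := by
  have : ((bt R').restrictScalars R).comp (bc R R') = (AlgHom.op (bc R R')).comp (bt R) := by
    apply hom_ext
    · simp [bc, bt]
    · simp [bc, bt]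
  exact AlgHom.congr_fun this u

theorem Fm_bc (R R' : Type) [CommRing R] [CommRing R'] [Algebra R R'] {m n : ℕ} {u : Weyl R}
    (hu : u ∈ Fm R m n) : bc R R' u ∈ Fm R' m n := by
  rw [mem_Fm_iff] at hu ⊢
  intro i j hij
  rw [cf_bc, hu i j hij, map_zero]

theorem pow_box {p : ℕ} (hp : p.Prime) {m n : ℕ} {u : Weyl R} (hu : u ∈ Fm R m n) (q : ℕ × ℕ)
    (h : ¬ (q.1 ≤ m ∧ q.2 ≤ n)) : cf R (u ^ p) (p * q.1, p * q.2) = 0 := by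
  refine (mem_Fm_iff _ _ _).1 (Fm_pow hu p) _ _ ?_
  rwa [Nat.mul_le_mul_left_iff hp.pos, Nat.mul_le_mul_left_iff hp.pos]

theorem neg_pow_op {B : Type} [Ring B] {p : ℕ} (ho : Odd p) (a : B) : (op (-a)) ^ p = op (-(a ^ p)) := by
  rw [← op_pow, ho.neg_pow]

theorem reduce [IsDomain R] {p : ℕ} (hp : p.Prime) (ho : Odd p) (hpR : (p : R) ≠ 0)
    (I : Ideal R) [I.IsMaximal] (hI : (p : R) ∈ I) (S A : Weyl R) (h : A * S = S * A + 1)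
    (hbS : bt R S = op S) (hbA : bt R A = op (-A)) (ms ns ma na : ℕ)
    (hS : S ∈ Fm R ms ns) (hA : A ∈ Fm R ma na) (hN : na + ms < p) (m n : ℕ) (c : R)
    (hc : c ∉ I) (hlead : A - c • mon R m n ∈ Lm R m n) : (m, n) = (0, 1) := by
  have hpk : (p : R ⧸ I) = 0 := by
    have := Ideal.Quotient.eq_zero_iff_mem.2 hI
    simpa using this
  have hch : CharP (R ⧸ I) p := (CharP.charP_iff_prime_eq_zero hp).2 hpk
  have h2 : (2 : R ⧸ I) ≠ 0 := by
    intro h2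
    have := (CharP.cast_eq_zero_iff (R ⧸ I) p 2).1 (by exact_mod_cast h2)
    have h3 := (Nat.prime_dvd_prime_iff_eq hp Nat.prime_two).1 this
    subst h3
    revert ho; decide
  set Sk := bc R (R ⧸ I) S with hSk
  set Ak := bc R (R ⧸ I) A with hAk
  have hk : Ak * Sk = Sk * Ak + 1 := by
    rw [hSk, hAk, ← map_mul, ← map_mul, h, map_add, map_one]
  have hbSk : bt (R ⧸ I) (Sk ^ p) = op ((1 : R ⧸ I) • (Sk ^ p)) := by
    rw [map_pow, hSk, bt_bc, hbS, unop_op, ← op_pow, one_smul]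
  have hbAk : bt (R ⧸ I) (Ak ^ p) = op ((-1 : R ⧸ I) • (Ak ^ p)) := by
    rw [map_pow, hAk, bt_bc, hbA, unop_op, map_neg, neg_pow_op ho]
    exact congrArg op (neg_one_smul (R ⧸ I) (bc R (R ⧸ I) A ^ p)).symm
  have hparS := parity hpk (Sk ^ p) 1 (fun i j hij => (pow_supp hp hpk hk i j hij).1) hbSk
  have hparA := parity hpk (Ak ^ p) (-1) (fun i j hij => (pow_supp hp hpk hk i j hij).2) hbAk
  set B := ms + ns + ma + na + 1 with hB
  set D := Finset.range B ×ˢ Finset.range B with hD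
  have hDS : ∀ q, q ∉ D → cf R (S ^ p) (p * q.1, p * q.2) = 0 := by
    intro q hq
    refine pow_box hp hS q ?_
    intro hle
    exact hq (by rw [hD, Finset.mem_product, Finset.mem_range, Finset.mem_range]; omega)
  have hDA : ∀ q, q ∉ D → cf R (A ^ p) (p * q.1, p * q.2) = 0 := by
    intro q hq
    refine pow_box hp hA q ?_
    intro hle
    exact hq (by rw [hD, Finset.mem_product, Finset.mem_range, Finset.mem_range]; omega)
  have hdiv : ∀ i j, ¬ (p ∣ i ∧ p ∣ j) →
      (∃ t, cf R (S ^ p) (i, j) = (p : R) * t) ∧ (∃ t, cf R (A ^ p) (i, j) = (p : R) * t) := by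
    intro i j hij
    set J := Ideal.span {(p : R)}
    have hpJ : (p : R ⧸ J) = 0 := by
      have := Ideal.Quotient.eq_zero_iff_mem.2 (Ideal.mem_span_singleton_self (p : R))
      simpa using this
    have hk : bc R (R ⧸ J) A * bc R (R ⧸ J) S = bc R (R ⧸ J) S * bc R (R ⧸ J) A + 1 := by
      rw [← map_mul, ← map_mul, h, map_add, map_one]
    have h1 := pow_supp hp hpJ hk i j hij
    rw [← map_pow, ← map_pow, cf_bc, cf_bc, Ideal.Quotient.algebraMap_eq,
      Ideal.Quotient.eq_zero_iff_mem, Ideal.Quotient.eq_zero_iff_mem, Ideal.mem_span_singleton,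
      Ideal.mem_span_singleton] at h1
    exact h1
  -- jacobian
  have hJ : ∀ M N : ℕ, (∑ q ∈ D, ∑ r ∈ D, if q.1 + r.1 = M + 1 ∧ q.2 + r.2 = N + 1 then
      ((q.2 : R ⧸ I) * r.1 - q.1 * r.2) * cf (R ⧸ I) (Ak ^ p) (p * q.1, p * q.2)
        * cf (R ⧸ I) (Sk ^ p) (p * r.1, p * r.2) else 0) = if M = 0 ∧ N = 0 then 1 else 0 := by
    intro M N
    set J := Ideal.span {(p : R) * p}
    have hpJ : (p : R ⧸ J) * p = 0 := by
      have := Ideal.Quotient.eq_zero_iff_mem.2 (Ideal.mem_span_singleton_self ((p : R) * p))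
      rw [map_mul, map_natCast] at this
      exact this
    have hk : bc R (R ⧸ J) A * bc R (R ⧸ J) S = bc R (R ⧸ J) S * bc R (R ⧸ J) A + 1 := by
      rw [← map_mul, ← map_mul, h, map_add, map_one]
    have hpw := pw_comm (B := Weyl (R ⧸ J)) hp (w_cast (by push_cast; exact hpJ)) hk
    rw [← map_pow, ← map_pow] at hpw
    have h1 := jac hp hpJ D _ _ hpw
      (by
        intro i j hij
        obtain ⟨t, ht⟩ := (hdiv i j hij).1
        exact ⟨algebraMap R _ t, by rw [cf_bc, ht]; simp⟩)
      (by intro q hq; rw [cf_bc, hDS q hq, map_zero])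
      (by
        intro i j hij
        obtain ⟨t, ht⟩ := (hdiv i j hij).2
        exact ⟨algebraMap R _ t, by rw [cf_bc, ht]; simp⟩)
      (by intro q hq; rw [cf_bc, hDA q hq, map_zero]) M N
    set σ₀ : R := ∑ q ∈ D, ∑ r ∈ D, if q.1 + r.1 = M + 1 ∧ q.2 + r.2 = N + 1 then
      ((q.2 : R) * r.1 - q.1 * r.2) * cf R (A ^ p) (p * q.1, p * q.2)
        * cf R (S ^ p) (p * r.1, p * r.2) else 0 with hσ
    have hmap : ∀ (R' : Type) [CommRing R'] [Algebra R R'],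
        (∑ q ∈ D, ∑ r ∈ D, if q.1 + r.1 = M + 1 ∧ q.2 + r.2 = N + 1 then
        ((q.2 : R') * r.1 - q.1 * r.2) * cf R' (bc R R' (A ^ p)) (p * q.1, p * q.2)
        * cf R' (bc R R' (S ^ p)) (p * r.1, p * r.2) else 0) = algebraMap R R' σ₀ := by
      intro R' _ _
      rw [hσ, map_sum]
      refine Finset.sum_congr rfl fun q _ => ?_
      rw [map_sum]
      refine Finset.sum_congr rfl fun r _ => ?_
      rw [cf_bc, cf_bc]
      split_ifs <;> simp
    rw [hmap] at h1
    have hk2 := hmap (R ⧸ I)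
    rw [map_pow (bc R (R ⧸ I)), map_pow (bc R (R ⧸ I))] at hk2
    rw [hk2]
    have h2 : Ideal.Quotient.mk J ((p.factorial : R) * (σ₀ - if M = 0 ∧ N = 0 then 1 else 0)) = 0 := by
      rw [mul_sub, map_sub, sub_eq_zero, map_mul, map_mul, map_natCast]
      have hδ : Ideal.Quotient.mk J (if M = 0 ∧ N = 0 then 1 else 0) =
          if M = 0 ∧ N = 0 then 1 else 0 := by split_ifs <;> simp
      rw [hδ]
      exact h1
    rw [Ideal.Quotient.eq_zero_iff_mem, Ideal.mem_span_singleton] at h2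
    obtain ⟨t, ht⟩ := h2
    obtain ⟨k, rfl⟩ : ∃ k, p = k + 1 := ⟨p - 1, by have := hp.pos; omega⟩
    rw [Nat.factorial_succ, Nat.cast_mul, mul_assoc, mul_assoc] at ht
    have h3 := mul_left_cancel₀ hpR ht
    have h4 := congrArg (algebraMap R (R ⧸ I)) h3
    rw [map_mul, map_mul, map_natCast, map_natCast, hpk, zero_mul, map_sub, mul_eq_zero] at h4
    rcases h4 with h4 | h4
    · exfalso
      have := (CharP.cast_eq_zero_iff (R ⧸ I) (k + 1) _).1 h4
      rw [hp.dvd_factorial] at this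
      omega
    · rw [sub_eq_zero] at h4
      rw [h4]
      split_ifs <;> simp
  have key := comm_lemma p na ms hN D (fun q => cf (R ⧸ I) (Ak ^ p) (p * q.1, p * q.2))
    (fun q => cf (R ⧸ I) (Sk ^ p) (p * q.1, p * q.2))
    (by intro q hq; simp only [hAk]; rw [← map_pow, cf_bc, hDA q hq, map_zero])
    (by intro q hq; simp only [hSk]; rw [← map_pow, cf_bc, hDS q hq, map_zero])
    (by
      intro q hq
      by_contra hodd
      rw [Nat.not_odd_iff_even] at hodd
      have := hparA (p * q.1) (p * q.2)
      rw [(hodd.mul_left p).neg_one_pow, one_mul] at this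
      have h3 : 2 * cf (R ⧸ I) (Ak ^ p) (p * q.1, p * q.2) = 0 := by linear_combination this
      exact hq ((mul_eq_zero.1 h3).resolve_left h2))
    (by
      intro q hq
      by_contra hodd
      rw [Nat.not_even_iff_odd] at hodd
      have := hparS (p * q.1) (p * q.2)
      rw [(ho.mul hodd).neg_one_pow, one_mul] at this
      have h3 : 2 * cf (R ⧸ I) (Sk ^ p) (p * q.1, p * q.2) = 0 := by linear_combination -this
      exact hq ((mul_eq_zero.1 h3).resolve_left h2))
    (by
      intro q hq
      by_contra hle
      exact hq (pow_box hp (Fm_bc R (R ⧸ I) hA) q (by omega)))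
    (by
      intro q hq
      by_contra hle
      exact hq (pow_box hp (Fm_bc R (R ⧸ I) hS) q (by omega)))
    hJ (m, n)
  apply key
  simp only [hAk]
  rw [← map_pow, cf_bc, lead_pow_cf hlead, map_pow]
  refine pow_ne_zero _ ?_
  intro h0
  exact hc (Ideal.Quotient.eq_zero_iff_mem.1 h0)

end reduce
end WD
namespace WD
open MulOpposite
section spread
variable {K : Type} [Field K] [CharZero K]

theorem bc_inj (R R' : Type) [CommRing R] [CommRing R'] [Algebra R R']
    (hi : Function.Injective (algebraMap R R')) : Function.Injective (bc R R') := by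
  intro u v h
  apply cf_inj
  ext q
  apply hi
  rw [← cf_bc, ← cf_bc, h]

theorem exists_lift (R : Subalgebra ℤ K) (u : Weyl K) (h : ∀ q, cf K u q ∈ R) :
    ∃ v : Weyl R, bc R K v = u := by
  classical
  refine ⟨ofc R (Finsupp.onFinset (cf K u).support (fun q => (⟨cf K u q, h q⟩ : R)) ?_), ?_⟩
  · intro q hq
    rw [Finsupp.mem_support_iff]
    intro h0
    exact hq (Subtype.ext h0)
  · apply cf_inj
    ext q
    rw [cf_bc, cf_ofc]
    rfl

theorem exists_box {R : Type} [CommRing R] (u : Weyl R) : ∃ m n, u ∈ Fm R m n := by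
  refine ⟨(cf R u).support.sup Prod.fst, (cf R u).support.sup Prod.snd, ?_⟩
  rw [mem_Fm_iff]
  intro i j hij
  by_contra hc
  apply hij
  have := Finsupp.mem_support_iff.2 hc
  exact ⟨Finset.le_sup (f := Prod.fst) this, Finset.le_sup (f := Prod.snd) this⟩

theorem exists_lead {R : Type} [CommRing R] (u : Weyl R) (hu : u ≠ 0) :
    ∃ m n, cf R u (m, n) ≠ 0 ∧ u - cf R u (m, n) • mon R m n ∈ Lm R m n := by
  have hne : (cf R u).support.Nonempty := by
    rw [Finsupp.support_nonempty_iff]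
    intro h
    exact hu (cf_inj (by rw [h, map_zero]))
  obtain ⟨q, hq, hqm⟩ := Finset.exists_max_image (cf R u).support
    (fun q => toLex (q.2, q.1)) hne
  refine ⟨q.1, q.2, Finsupp.mem_support_iff.1 hq, ?_⟩
  rw [mem_Lm_iff]
  intro i j hij
  have hs : cf R (u - cf R u (q.1, q.2) • mon R q.1 q.2) (i, j) =
      cf R u (i, j) - cf R u q * cf R (mon R q.1 q.2) (i, j) := by
    rw [map_sub, map_smul]; rfl
  rw [hs, cf_mon, Finsupp.single_apply]
  split_ifs with he
  · rw [← he]; simp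
  · rw [mul_zero, sub_zero]
    by_contra hc
    have := hqm (i, j) (Finsupp.mem_support_iff.2 hc)
    rw [Prod.Lex.toLex_le_toLex] at this
    simp only at this
    apply he
    have h1 : q.1 = i ∧ q.2 = j := by omega
    rw [h1.1, h1.2]

theorem jac_int : IsJacobsonRing ℤ := by
  rw [isJacobsonRing_iff_prime_eq]
  intro P hP
  by_cases h : P = ⊥
  · subst h
    rw [eq_bot_iff]
    intro x hx
    rw [Ideal.mem_jacobson_bot] at hx
    have h1 := Int.isUnit_iff.1 (hx x)
    rw [Ideal.mem_bot]
    rcases h1 with h1 | h1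
    · have : x * x = 0 := by linarith
      exact mul_self_eq_zero.1 this
    · nlinarith [mul_self_nonneg x]
  · have := IsPrime.to_maximal_ideal h
    exact Ideal.jacobson_eq_self_of_isMaximal

theorem char_pos (F : Type) [Field F] [Algebra.FiniteType ℤ F] : ∃ p : ℕ, p.Prime ∧ CharP F p := by
  obtain ⟨p, hp⟩ := CharP.exists F
  rcases CharP.char_is_prime_or_zero F p with h | h
  · exact ⟨p, h, hp⟩
  · exfalso
    subst h
    have : CharZero F := CharP.charP_to_charZero F
    have hj := jac_int
    have hfin := finite_of_finite_type_of_isJacobsonRing ℤ F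
    have hint : Algebra.IsIntegral ℤ F := inferInstance
    have hinj : Function.Injective (algebraMap ℤ F) := by
      intro a b h; simpa using h
    have := isField_of_isIntegral_of_isField hinj (Field.toIsField F)
    exact Int.not_isField this

theorem main_lead (S A : Weyl K) (h : A * S = S * A + 1)
    (hbS : bt K S = op S) (hbA : bt K A = op (-A)) (m n : ℕ)
    (hc : cf K A (m, n) ≠ 0) (hlead : A - cf K A (m, n) • mon K m n ∈ Lm K m n) :
    (m, n) = (0, 1) := by
  classical
  obtain ⟨ms, ns, hS⟩ := exists_box S
  obtain ⟨ma, na, hA⟩ := exists_box A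
  set c := cf K A (m, n) with hcdef
  set N := na + ms + 2 with hN
  set G : Finset K := (cf K S).support.image (cf K S) ∪ (cf K A).support.image (cf K A) ∪
    {c⁻¹, ((N.factorial : ℕ) : K)⁻¹} with hG
  set R : Subalgebra ℤ K := Algebra.adjoin ℤ (G : Set K) with hR
  have hGR : ∀ g ∈ G, g ∈ R := fun g hg => Algebra.subset_adjoin hg
  have hSR : ∀ q, cf K S q ∈ R := by
    intro q
    by_cases hq : cf K S q = 0
    · rw [hq]; exact R.zero_mem
    · exact hGR _ (by
        rw [hG]; exact Finset.mem_union_left _ (Finset.mem_union_left _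
          (Finset.mem_image_of_mem _ (Finsupp.mem_support_iff.2 hq))))
  have hAR : ∀ q, cf K A q ∈ R := by
    intro q
    by_cases hq : cf K A q = 0
    · rw [hq]; exact R.zero_mem
    · exact hGR _ (by
        rw [hG]; exact Finset.mem_union_left _ (Finset.mem_union_right _
          (Finset.mem_image_of_mem _ (Finsupp.mem_support_iff.2 hq))))
  have hcR : c⁻¹ ∈ R := hGR _ (by simp [hG])
  have hNR : ((N.factorial : ℕ) : K)⁻¹ ∈ R := hGR _ (by simp [hG])
  obtain ⟨S', hS'⟩ := exists_lift R S hSR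
  obtain ⟨A', hA'⟩ := exists_lift R A hAR
  have hinj : Function.Injective (algebraMap R K) := Subtype.val_injective
  have hbinj := bc_inj R K hinj
  have hft : Algebra.FiniteType ℤ R :=
    R.fg_iff_finiteType.1 (Subalgebra.fg_adjoin_finset G)
  obtain ⟨I, hI⟩ := Ideal.exists_maximal R
  have hftI : Algebra.FiniteType ℤ (R ⧸ I) :=
    Algebra.FiniteType.trans (S := R) hft inferInstance
  obtain ⟨p, hp, hch⟩ := @char_pos (R ⧸ I) (Ideal.Quotient.field I) hftI
  have hpI : (p : R) ∈ I := by
    rw [← Ideal.Quotient.eq_zero_iff_mem, map_natCast]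
    exact CharP.cast_eq_zero (R ⧸ I) p
  have hunit : ∀ x y : R, x * y = 1 → x ∉ I := by
    intro x y hxy hx
    exact hI.ne_top (I.eq_top_of_isUnit_mem hx (IsUnit.of_mul_eq_one y hxy))
  have hpN : N < p := by
    by_contra hle
    have hd : p ∣ N.factorial := (hp.dvd_factorial).2 (by omega)
    have hmem : ((N.factorial : ℕ) : R) ∈ I := by
      obtain ⟨t, ht⟩ := hd
      rw [ht, Nat.cast_mul]
      exact I.mul_mem_right _ hpI
    refine hunit _ ⟨_, hNR⟩ ?_ hmem
    apply Subtype.ext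
    change (((N.factorial : ℕ) : R) : K) * _ = 1
    have : (((N.factorial : ℕ) : R) : K) = ((N.factorial : ℕ) : K) := by simp
    rw [this]
    exact mul_inv_cancel₀ (by exact_mod_cast Nat.factorial_ne_zero N)
  have ho : Odd p := hp.odd_of_ne_two (by omega)
  have hpR : (p : R) ≠ 0 := by
    intro h0
    have := congrArg (algebraMap R K) h0
    rw [map_natCast, map_zero] at this
    exact hp.ne_zero (by exact_mod_cast this)
  have hFm : ∀ (u : Weyl R) (m n : ℕ), bc R K u ∈ Fm K m n → u ∈ Fm R m n := by
    intro u m n hu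
    rw [mem_Fm_iff] at hu ⊢
    intro i j hij
    apply hinj
    rw [← cf_bc, hu i j hij, map_zero]
  have hcA : algebraMap R K (cf R A' (m, n)) = c := by rw [← cf_bc, hA']
  refine reduce hp ho hpR I hpI S' A' ?_ ?_ ?_ ms ns ma na (hFm _ _ _ (by rw [hS']; exact hS))
    (hFm _ _ _ (by rw [hA']; exact hA)) (by omega) m n (cf R A' (m, n)) ?_ ?_
  · apply hbinj
    rw [map_mul, map_add, map_mul, map_one, hS', hA', h]
  · have h1 := bt_bc R K S'
    rw [hS', hbS] at h1
    have h2 := op_injective h1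
    rw [← hS'] at h2
    have h3 := hbinj h2
    exact (op_unop _).symm.trans (congrArg op h3.symm)
  · have h1 := bt_bc R K A'
    rw [hA', hbA] at h1
    have h2 := op_injective h1
    rw [← hA', ← map_neg] at h2
    have h3 := hbinj h2
    rw [h3, op_unop]
  · refine hunit _ ⟨_, hcR⟩ ?_
    apply hinj
    rw [map_mul, hcA, map_one]
    exact mul_inv_cancel₀ hc
  · rw [mem_Lm_iff] at hlead ⊢
    intro i j hij
    apply hinj
    rw [← cf_bc, map_sub, map_smul, bc_mon, hA', map_zero, ← algebraMap_smul K, hcA]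
    exact hlead i j hij

end spread
end WD

namespace WD
open MulOpposite
section final
variable {K : Type} [Field K] [CharZero K]

theorem gen_neg {B : Type} [Ring B] [Algebra K B] (r : B) (h : r = -r) : r = 0 := by
  have h2 : (2 : K) • r = 0 := by
    rw [two_smul]; nth_rewrite 2 [h]; exact add_neg_cancel r
  exact (smul_eq_zero.1 h2).resolve_left two_ne_zero

theorem gen_split {B : Type} [Ring B] [Algebra K B] (T : B →ₐ[K] Bᵐᵒᵖ) (A y : B) (c : K)
    (hA : T A = op (-A)) (hy : T y = op (-y)) (hr : T (A - c • y) = op (A - c • y)) :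
    A = c • y := by
  have h : A - c • y = -(A - c • y) := by
    apply op_injective
    rw [← hr, map_sub, map_smul, hA, hy, ← op_smul, ← op_sub]
    congr 1
    rw [smul_neg]; abel
  exact sub_eq_zero.1 (gen_neg (K := K) _ h)

theorem bt_low (r : Weyl K) (hr : r ∈ Lm K 0 1) : bt K r = op r := by
  induction hr using Submodule.span_induction with
  | mem u h =>
    obtain ⟨i, j, hij, rfl⟩ := h
    have : j = 0 := by omega
    subst this
    rw [mon, pow_zero, mul_one, map_pow, bt_x, op_pow]
  | zero => rw [map_zero, op_zero]
  | add a b _ _ ha hb => rw [map_add, ha, hb, op_add]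
  | smul c a _ ha => rw [map_smul, ha, op_smul]

theorem A_eq (S A : Weyl K) (h : A * S = S * A + 1)
    (hbS : bt K S = op S) (hbA : bt K A = op (-A)) : ∃ c : K, c ≠ 0 ∧ A = c • Wy K := by
  have hA0 : A ≠ 0 := by
    rintro rfl
    rw [zero_mul, mul_zero, zero_add] at h
    have h2 := congrArg (fun u => cf K u (0, 0)) h
    have h1 : (1 : Weyl K) = mon K 0 0 := by simp [mon]
    simp only [h1, cf_mon] at h2
    simp at h2
  obtain ⟨m, n, hc, hl⟩ := exists_lead A hA0
  have hmn := main_lead S A h hbS hbA m n hc hl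
  obtain ⟨rfl, rfl⟩ := Prod.mk.inj hmn
  have hm : mon K 0 1 = Wy K := by simp [mon]
  rw [hm] at hl
  exact ⟨_, hc, gen_split (bt K) A (Wy K) _ hbA bt_y (bt_low _ hl)⟩

theorem gen_S {B : Type} [Ring B] [Algebra K B] (S x y : B) (c : K) (hc : c ≠ 0)
    (hxy : y * x = x * y + 1) (h : (c • y) * S = S * (c • y) + 1) :
    y * (S - c⁻¹ • x) = (S - c⁻¹ • x) * y := by
  have h1 : y * S = S * y + c⁻¹ • (1 : B) := by
    have := congrArg (fun u => c⁻¹ • u) h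
    simpa [smul_add, smul_smul, hc] using this
  rw [mul_sub, sub_mul, h1, mul_smul_comm, hxy, smul_add, smul_mul_assoc]
  abel

theorem homs_agree (H : Weyl K) (hH : Wy K * H - H * Wy K = 0)
    {B : Type} [Ring B] [Algebra K B] (f g : Weyl K →ₐ[K] B) (hy : f (Wy K) = g (Wy K)) :
    f H = g H := by
  have h0 : ∀ i j, cf K H (i + 1, j) = 0 := by
    intro i j
    have h1 := cf_y H i j
    rw [hH, map_zero, Finsupp.zero_apply] at h1
    rcases mul_eq_zero.1 h1.symm with h2 | h2
    · exact absurd h2 (by exact_mod_cast Nat.succ_ne_zero i)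
    · exact h2
  rw [w_sum H, Finsupp.sum, map_sum, map_sum]
  refine Finset.sum_congr rfl fun q hq => ?_
  obtain ⟨i, j⟩ := q
  rcases i with _ | i
  · simp only [mon, map_smul, map_mul, map_pow, pow_zero, map_one, hy]
  · exact absurd (h0 i j) (Finsupp.mem_support_iff.1 hq)

theorem gen_g {B : Type} [Ring B] [Algebra K B] (x y t : B) (c : K) (hc : c ≠ 0)
    (hxy : y * x = x * y + 1) (ht : y * t = t * y) :
    (c⁻¹ • y) * (c • (x - t)) = (c • (x - t)) * (c⁻¹ • y) + 1 := by
  simp only [smul_mul_smul_comm, mul_smul_comm, smul_mul_assoc, smul_smul, inv_mul_cancel₀ hc,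
    mul_inv_cancel₀ hc, one_smul]
  rw [mul_sub, sub_mul, hxy, ht]; abel

theorem gen_t {B : Type} [Ring B] [Algebra K B] (y t : B) (c : K) (hc : c ≠ 0)
    (ht : (c⁻¹ • y) * t = t * (c⁻¹ • y)) : y * t = t * y := by
  have := congrArg (fun u => c • u) ht
  simpa [smul_smul, hc] using this

theorem gen_1 {B : Type} [Ring B] [Algebra K B] (x y : B) (c : K) (hc : c ≠ 0)
    (hxy : y * x = x * y + 1) : (c⁻¹ • y) * (c • x) = (c • x) * (c⁻¹ • y) + 1 := by
  simpa using gen_g x y 0 c hc hxy (by simp)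

theorem gen_2 {B : Type} [Ring B] [Algebra K B] (x t : B) (c : K) (hc : c ≠ 0) :
    c⁻¹ • (c • (x - t)) + t = x := by
  rw [smul_smul, inv_mul_cancel₀ hc, one_smul, sub_add_cancel]

theorem gen_3 {B : Type} [Ring B] [Algebra K B] (x S : B) (c : K) (hc : c ≠ 0) :
    c • (S - (S - c⁻¹ • x)) = x := by
  rw [sub_sub_cancel, smul_smul, mul_inv_cancel₀ hc, one_smul]

theorem gen_4 {B C : Type} [Ring B] [Algebra K B] [Ring C] [Algebra K C] (g : B →ₐ[K] C)
    (x S : B) (c : K) : g S = c⁻¹ • g x + g (S - c⁻¹ • x) := by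
  simp

theorem gen_5 {B C : Type} [Ring B] [Algebra K B] [Ring C] [Algebra K C] (g : B →ₐ[K] C)
    (x S : B) (c : K) : g (c • (x - S)) = c • (g x - g S) := by
  simp

theorem gen_6 {B : Type} [Ring B] (a b : B) (h : a = b) : a - b = 0 := sub_eq_zero.2 h

theorem bij (f : Weyl K →ₐ[K] Weyl K) (hS : bt K (f (Wx K)) = op (f (Wx K)))
    (hA : bt K (f (Wy K)) = op (-f (Wy K))) : Function.Bijective f := by
  have h : f (Wy K) * f (Wx K) = f (Wx K) * f (Wy K) + 1 := by
    rw [← map_mul, wrel, map_add, map_mul, map_one]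
  obtain ⟨c, hc, hAc⟩ := A_eq _ _ h hS hA
  set S := f (Wx K) with hSdef
  rw [hAc] at h
  have hH := gen_S S (Wx K) (Wy K) c hc (wrel K) h
  set H := S - c⁻¹ • Wx K with hHdef
  have hH0 : Wy K * H - H * Wy K = 0 := gen_6 _ _ hH
  let θ : Weyl K →ₐ[K] Weyl K := wlift (c • Wx K) (c⁻¹ • Wy K) (gen_1 _ _ c hc (wrel K))
  have hθy : θ (Wy K) = c⁻¹ • Wy K := wlift_y _ _ _
  have hθH : Wy K * θ H = θ H * Wy K := by
    apply gen_t _ _ c hc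
    rw [← hθy, ← map_mul, hH, map_mul]
  let g : Weyl K →ₐ[K] Weyl K := wlift (c • (Wx K - θ H)) (c⁻¹ • Wy K)
    (gen_g _ _ _ c hc (wrel K) hθH)
  have hgx : g (Wx K) = c • (Wx K - θ H) := wlift_x _ _ _
  have hgy : g (Wy K) = c⁻¹ • Wy K := wlift_y _ _ _
  have hgf : g.comp f = AlgHom.id K _ := by
    apply hom_ext
    · have h4 := gen_4 g (Wx K) S c
      have h5 : g (S - c⁻¹ • Wx K) = θ H := homs_agree H hH0 g θ (hgy.trans hθy.symm)
      rw [h5, hgx, gen_2 _ _ c hc] at h4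
      exact h4
    · change g (f (Wy K)) = Wy K
      rw [hAc, map_smul, hgy, smul_smul, mul_inv_cancel₀ hc, one_smul]
  have hfg : f.comp g = AlgHom.id K _ := by
    have hfy : f (c⁻¹ • Wy K) = Wy K := by
      rw [map_smul, hAc, smul_smul, inv_mul_cancel₀ hc, one_smul]
    apply hom_ext
    · change f (g (Wx K)) = Wx K
      rw [hgx, gen_5]
      have h5 : f (θ H) = H := homs_agree H hH0 (f.comp θ) (AlgHom.id K _) (by
        change f (θ (Wy K)) = Wy K
        rw [hθy, hfy])
      rw [h5]
      exact gen_3 _ _ c hc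
    · change f (g (Wy K)) = Wy K
      rw [hgy, hfy]
  exact Function.bijective_iff_has_inverse.2 ⟨g, fun u => DFunLike.congr_fun hgf u,
    fun u => DFunLike.congr_fun hfg u⟩

end final
end WD

namespace WD
open MulOpposite
section wrap
variable {K : Type} [Field K] [CharZero K]

def toHom {A : Type} [Semiring A] [Algebra K A] (f : A → A) (h : IsAlgEndo K f) : A →ₐ[K] A where
  toFun := f
  map_one' := h.2.2.2
  map_mul' := h.2.2.1
  map_zero' := by have := h.2.1 0 0; simpa using this
  map_add' := h.1
  commutes' r := by
    rw [Algebra.algebraMap_eq_smul_one, h.2.1, h.2.2.2]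

def toAnti {A : Type} [Semiring A] [Algebra K A] (f : A → A) (h : IsAntiEndo K f) :
    A →ₐ[K] Aᵐᵒᵖ where
  toFun u := op (f u)
  map_one' := by rw [h.2.2.2, op_one]
  map_mul' a b := by rw [h.2.2.1, op_mul]
  map_zero' := by have := h.2.1 0 0; simpa using this
  map_add' a b := by rw [h.1, op_add]
  commutes' r := by
    rw [Algebra.algebraMap_eq_smul_one, h.2.1, h.2.2.2, Algebra.algebraMap_eq_smul_one, op_smul,
      op_one]

theorem gen_psi {B : Type} [Ring B] [Algebra K B] (x y : B) (h : y * x = x * y + 1) :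
    (y - x) * ((2 : K)⁻¹ • (x + y)) = ((2 : K)⁻¹ • (x + y)) * (y - x) + 1 := by
  have key : (y - x) * (x + y) = (x + y) * (y - x) + (2 : K) • (1 : B) := by
    rw [two_smul]
    simp only [mul_add, mul_sub, add_mul, sub_mul, h]
    abel
  rw [mul_smul_comm, smul_mul_assoc, key, smul_add, smul_smul, inv_mul_cancel₀ two_ne_zero,
    one_smul]

theorem gen_phi {B : Type} [Ring B] [Algebra K B] (x y : B) (h : y * x = x * y + 1) :
    (x + (2 : K)⁻¹ • y) * (x - (2 : K)⁻¹ • y) = (x - (2 : K)⁻¹ • y) * (x + (2 : K)⁻¹ • y) + 1 := by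
  have h2 : (1 : B) = (2 : K)⁻¹ • (1 : B) + (2 : K)⁻¹ • (1 : B) := by
    rw [← add_smul, ← two_mul, mul_inv_cancel₀ two_ne_zero, one_smul]
  refine Eq.trans ?_ (congrArg (fun t => (x - (2 : K)⁻¹ • y) * (x + (2 : K)⁻¹ • y) + t) h2.symm)
  simp only [mul_add, mul_sub, add_mul, sub_mul, mul_smul_comm, smul_mul_assoc, h, smul_add, smul_sub]
  abel

theorem gen_7 {B C : Type} [Ring B] [Algebra K B] [Ring C] [Algebra K C] (g : B →ₐ[K] C) (x y : B) :
    g ((2 : K)⁻¹ • (x + y)) = (2 : K)⁻¹ • (g x + g y) := by simp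

theorem gen_8 {B C : Type} [Ring B] [Algebra K B] [Ring C] [Algebra K C] (g : B →ₐ[K] C) (x y : B) :
    g (y - x) = g y - g x := by simp

theorem gen_9 {B C : Type} [Ring B] [Algebra K B] [Ring C] [Algebra K C] (g : B →ₐ[K] C) (x y : B) :
    g (x - (2 : K)⁻¹ • y) = g x - (2 : K)⁻¹ • g y := by simp

theorem gen_10 {B C : Type} [Ring B] [Algebra K B] [Ring C] [Algebra K C] (g : B →ₐ[K] C)
    (x y : B) :
    g (x + (2 : K)⁻¹ • y) = g x + (2 : K)⁻¹ • g y := by simp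

theorem gen_half {B : Type} [Ring B] [Algebra K B] (x : B) : (2 : K)⁻¹ • (x + x) = x := by
  rw [← two_smul K, smul_smul, inv_mul_cancel₀ two_ne_zero, one_smul]

theorem gen_a {B : Type} [Ring B] [Algebra K B] (x y : B) :
    (2 : K)⁻¹ • ((x - (2 : K)⁻¹ • y) + (x + (2 : K)⁻¹ • y)) = x := by
  have : (x - (2 : K)⁻¹ • y) + (x + (2 : K)⁻¹ • y) = x + x := by abel
  rw [this, gen_half]

theorem gen_b {B : Type} [Ring B] [Algebra K B] (x y : B) :
    (x + (2 : K)⁻¹ • y) - (x - (2 : K)⁻¹ • y) = y := by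
  have : (x + (2 : K)⁻¹ • y) - (x - (2 : K)⁻¹ • y) = (2 : K)⁻¹ • (y + y) := by
    rw [smul_add]; abel
  rw [this, gen_half]

theorem gen_c {B : Type} [Ring B] [Algebra K B] (x y : B) :
    (2 : K)⁻¹ • (x + y) - (2 : K)⁻¹ • (y - x) = x := by
  rw [← smul_sub]
  have : x + y - (y - x) = x + x := by abel
  rw [this, gen_half]

theorem gen_d {B : Type} [Ring B] [Algebra K B] (x y : B) :
    (2 : K)⁻¹ • (x + y) + (2 : K)⁻¹ • (y - x) = y := by
  rw [← smul_add]
  have : x + y + (y - x) = y + y := by abel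
  rw [this, gen_half]

theorem gen_e {B C : Type} [Ring B] [Algebra K B] [Ring C] [Algebra K C] (g : B →ₐ[K] C) (x : B) :
    g (-x) = - g x := by simp

theorem gen_f {B : Type} [Ring B] [Algebra K B] (x y : B) :
    op y - op x = op (-(x - y)) := by simp

theorem gen_h {B : Type} [Ring B] [Algebra K B] (x y : B) :
    (2 : K)⁻¹ • (op y + op x) = op ((2 : K)⁻¹ • (x + y)) := by
  rw [op_smul, op_add, add_comm]

def psi (K : Type) [Field K] [CharZero K] : Weyl K →ₐ[K] Weyl K :=
  wlift ((2 : K)⁻¹ • (Wx K + Wy K)) (Wy K - Wx K) (gen_psi _ _ (wrel K))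
def phi (K : Type) [Field K] [CharZero K] : Weyl K →ₐ[K] Weyl K :=
  wlift (Wx K - (2 : K)⁻¹ • Wy K) (Wx K + (2 : K)⁻¹ • Wy K) (gen_phi _ _ (wrel K))

theorem psi_x : psi K (Wx K) = (2 : K)⁻¹ • (Wx K + Wy K) := wlift_x _ _ _
theorem psi_y : psi K (Wy K) = Wy K - Wx K := wlift_y _ _ _
theorem phi_x : phi K (Wx K) = Wx K - (2 : K)⁻¹ • Wy K := wlift_x _ _ _
theorem phi_y : phi K (Wy K) = Wx K + (2 : K)⁻¹ • Wy K := wlift_y _ _ _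

theorem phi_psi (u : Weyl K) : phi K (psi K u) = u := by
  have : (phi K).comp (psi K) = AlgHom.id K _ := by
    apply hom_ext
    · change phi K (psi K (Wx K)) = Wx K
      rw [psi_x, gen_7, phi_x, phi_y]; exact gen_a _ _
    · change phi K (psi K (Wy K)) = Wy K
      rw [psi_y, gen_8, phi_x, phi_y]; exact gen_b (K := K) _ _
  exact DFunLike.congr_fun this u

theorem psi_phi (u : Weyl K) : psi K (phi K u) = u := by
  have : (psi K).comp (phi K) = AlgHom.id K _ := by
    apply hom_ext
    · change psi K (phi K (Wx K)) = Wx K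
      rw [phi_x, gen_9, psi_x, psi_y]; exact gen_c _ _
    · change psi K (phi K (Wy K)) = Wy K
      rw [phi_y, gen_10, psi_x, psi_y]; exact gen_d _ _
  exact DFunLike.congr_fun this u

theorem alpha_psi (α : Weyl K → Weyl K) (hα : IsExchange K α) (u : Weyl K) :
    α (psi K u) = psi K (unop (bt K u)) := by
  let a := toAnti α hα.1.1.1
  have hax : a (Wx K) = op (Wy K) := congrArg op hα.2.1
  have hay : a (Wy K) = op (Wx K) := congrArg op hα.2.2
  have : a.comp (psi K) = (AlgHom.op (psi K)).comp (bt K) := by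
    apply hom_ext
    · change a (psi K (Wx K)) = op (psi K (unop (bt K (Wx K))))
      rw [bt_x, unop_op, psi_x, gen_7, hax, hay]; exact gen_h _ _
    · change a (psi K (Wy K)) = op (psi K (unop (bt K (Wy K))))
      rw [bt_y, unop_op, psi_y, gen_8, hax, hay, gen_e, psi_y]; exact gen_f (K := K) _ _
  exact op_injective (DFunLike.congr_fun this u)

theorem bij_of_comm (α : Weyl K → Weyl K) (hα : IsExchange K α) (F : Weyl K → Weyl K)
    (hF : IsAlgEndo K F) (hc : ∀ u, F (α u) = α (F u)) : Function.Bijective F := by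
  let F' := toHom F hF
  let f : Weyl K →ₐ[K] Weyl K := (phi K).comp (F'.comp (psi K))
  have hb : ∀ u, bt K (f u) = op (f (unop (bt K u))) := by
    intro u
    have h1 : α (F (psi K u)) = psi K (unop (bt K (f u))) := by
      rw [← alpha_psi α hα]
      change _ = α (psi K (phi K (F (psi K u))))
      rw [psi_phi]
    rw [← hc, alpha_psi α hα] at h1
    have h2 := congrArg (phi K) h1
    rw [phi_psi] at h2
    exact ((congrArg op h2).trans (op_unop _)).symm
  have hf : Function.Bijective f := by
    apply bij
    · rw [hb, bt_x, unop_op]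
    · rw [hb, bt_y, unop_op, gen_e]
  have hFe : F = psi K ∘ f ∘ phi K := by
    funext u
    change F u = psi K (phi K (F (psi K (phi K u))))
    rw [psi_phi, psi_phi]
  have b1 : Function.Bijective (psi K) :=
    Function.bijective_iff_has_inverse.2 ⟨phi K, phi_psi, psi_phi⟩
  have b2 : Function.Bijective (phi K) :=
    Function.bijective_iff_has_inverse.2 ⟨psi K, psi_phi, phi_psi⟩
  rw [hFe]
  exact b1.comp (hf.comp b2)

theorem inv_endo {A : Type} [Semiring A] [Algebra K A] (g : A → A) (hg : IsAlgAuto K g) :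
    IsAlgEndo K (Function.invFun g) := by
  have hr := Function.rightInverse_invFun hg.2.2
  have hi := hg.2.1
  refine ⟨fun a b => hi ?_, fun c a => hi ?_, fun a b => hi ?_, hi ?_⟩
  · rw [hr, hg.1.1, hr, hr]
  · rw [hr, hg.1.2.1, hr]
  · rw [hr, hg.1.2.2.1, hr, hr]
  · rw [hr, hg.1.2.2.2]

theorem conj_auto (α γ : Weyl K → Weyl K) (hα : IsExchange K α) (h : ConjToAlpha K α γ) :
    ∃ g, IsAlgAuto K g ∧ ∀ u, g (γ u) = α (g u) := by
  obtain ⟨g, hg, rfl⟩ := h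
  have hbij : Function.Bijective g := hg.elim (fun h => h.2) (fun h => h.2)
  have hr := Function.rightInverse_invFun hbij.2
  have key : ∀ u, g ((Function.invFun g ∘ α ∘ g) u) = α (g u) := fun u => hr _
  rcases hg with hg | hg
  · exact ⟨g, hg, key⟩
  · have ha := hα.1.1
    refine ⟨α ∘ g, ⟨⟨?_, ?_, ?_, ?_⟩, ha.2.comp hbij⟩, ?_⟩
    · intro a b; simp only [Function.comp_apply]; rw [hg.1.1, ha.1.1]
    · intro a b; simp only [Function.comp_apply]; rw [hg.1.2.1, ha.1.2.1]
    · intro a b; simp only [Function.comp_apply]; rw [hg.1.2.2.1, ha.1.2.2.1]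
    · simp only [Function.comp_apply]; rw [hg.1.2.2.2, ha.1.2.2.2]
    · intro u
      exact congrArg α (key u)

theorem main (α : Weyl K → Weyl K) (hα : IsExchange K α) :
    (∀ f : Weyl K → Weyl K, IsAlgEndo K f → IsAlgAuto K f) ↔
    (∀ f : Weyl K → Weyl K, IsAlgEndo K f →
      ∃ γ δ : Weyl K → Weyl K,
        IsInvolutionOn K γ ∧ ConjToAlpha K α γ ∧
        IsInvolutionOn K δ ∧ ConjToAlpha K α δ ∧
        f ∘ γ = δ ∘ f) := by
  constructor
  · intro H f hf
    have hfa := H f hf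
    have ha := hα.1.1
    have hr := Function.rightInverse_invFun hfa.2.2
    have hl := Function.leftInverse_invFun hfa.2.1
    have hi := inv_endo f hfa
    have haa : ∀ u, α (α u) = u := fun u => congrFun hα.1.2 u
    have hib : Function.Bijective (Function.invFun f) :=
      Function.bijective_iff_has_inverse.2 ⟨f, hr, hl⟩
    refine ⟨Function.invFun f ∘ α ∘ f, α, ⟨⟨⟨?_, ?_, ?_, ?_⟩, hib.comp (ha.2.comp hfa.2)⟩, ?_⟩,
      ⟨f, Or.inl hfa, rfl⟩, hα.1, ⟨id, Or.inl ⟨⟨fun _ _ => rfl, fun _ _ => rfl, fun _ _ => rfl, rfl⟩,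
        Function.bijective_id⟩, ?_⟩, ?_⟩
    · intro a b; simp only [Function.comp_apply]; rw [hf.1, ha.1.1, hi.1]
    · intro a b; simp only [Function.comp_apply]; rw [hf.2.1, ha.1.2.1, hi.2.1]
    · intro a b; simp only [Function.comp_apply]; rw [hf.2.2.1, ha.1.2.2.1, hi.2.2.1]
    · simp only [Function.comp_apply]; rw [hf.2.2.2, ha.1.2.2.2, hi.2.2.2]
    · funext u
      simp only [Function.comp_apply, id]
      rw [hr, haa, hl]
    · have : Function.invFun (id : Weyl K → Weyl K) = id :=
        funext fun u => Function.leftInverse_invFun (f := (id : Weyl K → Weyl K))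
          Function.injective_id u
      rw [this]; rfl
    · funext u
      exact hr _
  · intro H f hf
    obtain ⟨γ, δ, -, hγ, -, hδ, hfe⟩ := H f hf
    obtain ⟨g, hg, hgγ⟩ := conj_auto α γ hα hγ
    obtain ⟨h, hh, hhδ⟩ := conj_auto α δ hα hδ
    have hr := Function.rightInverse_invFun hg.2.2
    have hl := Function.leftInverse_invFun hg.2.1
    have hi := inv_endo g hg
    have hF : IsAlgEndo K (h ∘ f ∘ Function.invFun g) := by
      refine ⟨?_, ?_, ?_, ?_⟩
      · intro a b; simp only [Function.comp_apply]; rw [hi.1, hf.1, hh.1.1]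
      · intro a b; simp only [Function.comp_apply]; rw [hi.2.1, hf.2.1, hh.1.2.1]
      · intro a b; simp only [Function.comp_apply]; rw [hi.2.2.1, hf.2.2.1, hh.1.2.2.1]
      · simp only [Function.comp_apply]; rw [hi.2.2.2, hf.2.2.2, hh.1.2.2.2]
    have hb := bij_of_comm α hα _ hF (by
      intro u
      simp only [Function.comp_apply]
      have h1 : Function.invFun g (α u) = γ (Function.invFun g u) := by
        apply hg.2.1
        rw [hr, hgγ, hr]
      rw [h1, ← hhδ]
      exact congrArg h (congrFun hfe _))
    refine ⟨hf, ?_⟩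
    have h2 : Function.Bijective (h ∘ f) := by
      have := hb.comp hg.2
      have e : (h ∘ f ∘ Function.invFun g) ∘ g = h ∘ f := by
        funext u; simp only [Function.comp_apply]; rw [hl]
      rwa [e] at this
    exact (Function.Bijective.of_comp_iff' hh.2 f).1 h2

end wrap
end WD

/-- the Dixmier conjecture is equivalent to the γ,δ conjecture (first version). -/
theorem stmt_3 {K : Type} [Field K] [CharZero K]
    (α : Weyl K → Weyl K) (hα : IsExchange K α) :
    (∀ f : Weyl K → Weyl K, IsAlgEndo K f → IsAlgAuto K f) ↔
    (∀ f : Weyl K → Weyl K, IsAlgEndo K f →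
      ∃ γ δ : Weyl K → Weyl K,
        IsInvolutionOn K γ ∧ ConjToAlpha K α γ ∧
        IsInvolutionOn K δ ∧ ConjToAlpha K α δ ∧
        f ∘ γ = δ ∘ f) :=
  WD.main α hα
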